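/- arXiv:2211.02173 — 2 statements merged into one kernel-verified Lean document; each statement's English description precedes it below -/
import Mathlib

section
/- If E ∈ ℝ satisfies E ∉ Σ₁, then (E − S) ∩ Σ₀ = ∅, and for all v, v' ∈ S and all unstable sections d of (T, A_{E−v}) and d' of (T, A_{E−v'}), the maps d and d' are homotopic. -/
open MeasureTheory Topology
open scoped Pointwise ENNReal

noncomputable section

/-- The real projective line, as the projectivization of `ℝ²`. -/
abbrev RP1 : Type := Projectivization ℝ (Fin 2 → ℝ)

instance : TopologicalSpace RP1 :=
  inferInstanceAs (TopologicalSpace (Quotient (projectivizationSetoid ℝ (Fin 2 → ℝ))))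

abbrev SL2 : Type := Matrix.SpecialLinearGroup (Fin 2) ℝ

/-- The action of `SL(2,ℝ)` on `ℝP¹`: `A · span v = span (A v)`. -/
def SL2act (A : SL2) (p : RP1) : RP1 :=
  Projectivization.map ((A : Matrix (Fin 2) (Fin 2) ℝ).mulVecLin)
    (by
      rw [Matrix.coe_mulVecLin]
      exact Matrix.mulVec_injective_iff_isUnit.2
        ((Matrix.isUnit_iff_isUnit_det _).2 (by simp))) p

/-- The Schrödinger cocycle matrix `A_E(x)`. -/
def schrodingerCocycle {X : Type*} (f : X → ℝ) (E : ℝ) (x : X) : SL2 :=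
  ⟨!![E - f x, -1; 1, 0], by simp [Matrix.det_fin_two_of]⟩

/-- Iterates `A^n(x) = A(T^{n-1}x) ⋯ A(x)` for `n ∈ ℕ`. -/
def cocIterN {X : Type*} (T : X → X) (A : X → SL2) : ℕ → X → SL2
  | 0, _ => 1
  | n + 1, x => A (T^[n] x) * cocIterN T A n x

/-- Iterates `A^n(x)` for `n ∈ ℤ`, with `A^{-n}(x) = (A^n(T^{-n}x))⁻¹`. -/
def cocIterZ {X : Type*} [TopologicalSpace X] (T : X ≃ₜ X) (A : X → SL2) (n : ℤ) (x : X) : SL2 :=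
  if 0 ≤ n then cocIterN T A n.toNat x
  else (cocIterN T A (-n).toNat ((⇑T.symm)^[(-n).toNat] x))⁻¹

/-- An invariant section of the cocycle `(T, A)`. -/
def IsInvariantSection {X : Type*} [TopologicalSpace X] (T : X ≃ₜ X) (A : X → SL2)
    (d : C(X, RP1)) : Prop :=
  ∀ x, SL2act (A x) (d x) = d (T x)

/-- An unstable section of the cocycle `(T, A)`. -/
def IsUnstableSection {X : Type*} [TopologicalSpace X] (T : X ≃ₜ X) (A : X → SL2)
    (d : C(X, RP1)) : Prop :=
  IsInvariantSection T A d ∧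
    ∃ C > 0, ∃ l > 1, ∀ (x : X) (n : ℕ) (v : Fin 2 → ℝ) (hv : v ≠ 0),
      Projectivization.mk ℝ v hv = d x →
        ‖((cocIterZ T A (-(n : ℤ)) x : Matrix (Fin 2) (Fin 2) ℝ).mulVec v)‖ ≤ C * (l ^ n)⁻¹ * ‖v‖

section Spectral

variable {V : Type*} [NormedAddCommGroup V] [InnerProductSpace ℝ V] [CompleteSpace V]

open scoped InnerProductSpace

/-- A symmetric bounded operator which is nonnegative and invertible is coercive. -/
lemma exists_pos_mul_sq_le_inner_of_isUnit {B : V →L[ℝ] V} (hB : IsSelfAdjoint B)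
    (hpos : ∀ ψ, 0 ≤ ⟪B ψ, ψ⟫_ℝ) (hu : IsUnit B) :
    ∃ c > 0, ∀ ψ, c * ‖ψ‖ ^ 2 ≤ ⟪B ψ, ψ⟫_ℝ := by
  obtain ⟨u, rfl⟩ := hu
  set B : V →L[ℝ] V := (u : V →L[ℝ] V) with hBdef
  set R : V →L[ℝ] V := ((u⁻¹ : (V →L[ℝ] V)ˣ) : V →L[ℝ] V)
  have hRB : ∀ ψ, R (B ψ) = ψ := fun ψ => by
    have : R * B = 1 := u.inv_mul
    simpa using congrArg (fun A : V →L[ℝ] V => A ψ) this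
  set K : ℝ := ‖B‖ + 1
  have hK : 0 < K := by positivity
  set r : ℝ := ‖R‖ + 1
  have hr : 0 < r := by positivity
  have h₁ : ∀ ψ, ‖B ψ‖ ^ 2 ≤ K * ⟪B ψ, ψ⟫_ℝ := by
    intro ψ
    have h := hpos (ψ - K⁻¹ • B ψ)
    have hs : ⟪B (B ψ), ψ⟫_ℝ = ‖B ψ‖ ^ 2 := by
      rw [← real_inner_self_eq_norm_sq]; exact hB.isSymmetric (B ψ) ψ
    have hb : ⟪B (B ψ), B ψ⟫_ℝ ≤ K * ‖B ψ‖ ^ 2 := by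
      calc ⟪B (B ψ), B ψ⟫_ℝ ≤ ‖B (B ψ)‖ * ‖B ψ‖ := real_inner_le_norm _ _
        _ ≤ (K * ‖B ψ‖) * ‖B ψ‖ := by
          gcongr
          exact (B.le_opNorm _).trans (by gcongr; simp [K])
        _ = _ := by ring
    simp only [map_sub, map_smul, inner_sub_left, inner_sub_right, inner_smul_left,
      inner_smul_right, hs, real_inner_self_eq_norm_sq] at h
    simp only [conj_trivial] at h
    have h' : K⁻¹ * (K⁻¹ * ⟪B (B ψ), B ψ⟫_ℝ) ≤ K⁻¹ * ‖B ψ‖ ^ 2 := by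
      have : K⁻¹ * (K⁻¹ * ⟪B (B ψ), B ψ⟫_ℝ) ≤ K⁻¹ * (K⁻¹ * (K * ‖B ψ‖ ^ 2)) := by gcongr
      rwa [inv_mul_cancel_left₀ hK.ne'] at this
    have h'' : K⁻¹ * ‖B ψ‖ ^ 2 ≤ ⟪B ψ, ψ⟫_ℝ := by linarith
    rwa [inv_mul_le_iff₀ hK] at h''
  refine ⟨(K * r ^ 2)⁻¹, by positivity, fun ψ => ?_⟩
  rw [inv_mul_le_iff₀ (by positivity)]
  have h₂ : ‖ψ‖ ≤ r * ‖B ψ‖ := by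
    calc ‖ψ‖ = ‖R (B ψ)‖ := by rw [hRB]
      _ ≤ ‖R‖ * ‖B ψ‖ := R.le_opNorm _
      _ ≤ _ := by gcongr; simp [r]
  calc ‖ψ‖ ^ 2 ≤ (r * ‖B ψ‖) ^ 2 := by gcongr
    _ = r ^ 2 * ‖B ψ‖ ^ 2 := by ring
    _ ≤ r ^ 2 * (K * ⟪B ψ, ψ⟫_ℝ) := by gcongr; exact h₁ ψ
    _ = _ := by ring

/-- A self-adjoint operator whose spectrum avoids the `δ`-neighbourhood of `a` satisfies
`‖A ψ - a ψ‖ ≥ δ ‖ψ‖`. -/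
lemma IsSelfAdjoint.mul_norm_le_norm_sub_smul {A : V →L[ℝ] V} (hA : IsSelfAdjoint A)
    {a δ : ℝ} (hδ : 0 ≤ δ) (hspec : ∀ b ∈ spectrum ℝ A, δ ≤ |b - a|) (ψ : V) :
    δ * ‖ψ‖ ≤ ‖A ψ - a • ψ‖ := by
  set D : V →L[ℝ] V := A - algebraMap ℝ _ a with hD
  have hDapp : ∀ ψ, D ψ = A ψ - a • ψ := fun ψ => by simp [hD, Algebra.algebraMap_eq_smul_one]
  have hDsa : ∀ ψ φ, ⟪D ψ, φ⟫_ℝ = ⟪ψ, D φ⟫_ℝ := fun ψ φ => by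
    have := hA.isSymmetric ψ φ
    simp only [ContinuousLinearMap.coe_coe] at this
    simp only [hDapp, inner_sub_left, inner_sub_right, inner_smul_left, inner_smul_right, this]
    simp
  set Q : Set ℝ := {t | ∃ ψ : V, ‖ψ‖ = 1 ∧ t = ‖D ψ‖ ^ 2} with hQ
  have hbdd : BddBelow Q := ⟨0, by rintro _ ⟨ψ, -, rfl⟩; positivity⟩
  by_contra! hlt
  have hψ : ψ ≠ 0 := by rintro rfl; simp at hlt
  have hψn : 0 < ‖ψ‖ := norm_pos_iff.2 hψ
  have hmem : ∀ φ : V, φ ≠ 0 → (‖D φ‖ / ‖φ‖) ^ 2 ∈ Q := fun φ hφ => by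
    refine ⟨‖φ‖⁻¹ • φ, ?_, ?_⟩
    · simp [norm_smul, hφ]
    · simp [norm_smul, div_eq_inv_mul]
  set m := sInf Q with hm
  have hm0 : 0 ≤ m := Real.sInf_nonneg (by rintro _ ⟨ψ, -, rfl⟩; positivity)
  have hmle : ∀ φ : V, m * ‖φ‖ ^ 2 ≤ ‖D φ‖ ^ 2 := fun φ => by
    rcases eq_or_ne φ 0 with rfl | hφ
    · simp
    · have := csInf_le hbdd (hmem φ hφ)
      rwa [div_pow, le_div_iff₀ (by positivity)] at this
  have hmlt : m < δ ^ 2 := by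
    refine (csInf_le hbdd (hmem ψ hψ)).trans_lt ?_
    rw [← hDapp] at hlt
    have : ‖D ψ‖ / ‖ψ‖ < δ := by rwa [div_lt_iff₀ hψn]
    gcongr
  set s := √m with hs
  have hss : s * s = m := Real.mul_self_sqrt hm0
  have hs0 : 0 ≤ s := Real.sqrt_nonneg _
  have hslt : s < δ := by
    by_contra! h
    nlinarith
  have hunit : ∀ t : ℝ, |t| < δ → IsUnit (D - algebraMap ℝ (V →L[ℝ] V) t) := fun t ht => by
    have : a + t ∉ spectrum ℝ A := fun h => by
      have := hspec _ h
      rw [add_sub_cancel_left] at this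
      linarith
    rw [spectrum.notMem_iff] at this
    have h := this.neg
    rwa [neg_sub, map_add, ← sub_sub] at h
  set B : V →L[ℝ] V := (D - algebraMap ℝ _ s) * (D - algebraMap ℝ _ (-s)) with hB
  have hBu : IsUnit B := (hunit s (by rwa [abs_of_nonneg hs0])).mul
    (hunit (-s) (by rwa [abs_neg, abs_of_nonneg hs0]))
  have hBapp : ∀ φ, B φ = D (D φ) - m • φ := fun φ => by
    simp only [hB, Algebra.algebraMap_eq_smul_one, mul_apply_eq_comp,
      sub_apply, smul_apply,
      one_apply_eq_self, map_sub, map_smul, ← hss]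
    module
  have hBsa : IsSelfAdjoint B := by
    rw [ContinuousLinearMap.isSelfAdjoint_iff_isSymmetric]
    intro φ χ
    simp only [ContinuousLinearMap.coe_coe, hBapp, inner_sub_left, inner_sub_right,
      inner_smul_left, inner_smul_right, hDsa]
    simp
  have hBin : ∀ φ, ⟪B φ, φ⟫_ℝ = ‖D φ‖ ^ 2 - m * ‖φ‖ ^ 2 := fun φ => by
    rw [hBapp, inner_sub_left, hDsa, inner_smul_left, real_inner_self_eq_norm_sq,
      real_inner_self_eq_norm_sq]
    simp
  obtain ⟨c, hc, hcle⟩ := exists_pos_mul_sq_le_inner_of_isUnit hBsa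
    (fun φ => by rw [hBin]; linarith [hmle φ]) hBu
  have : m + c ≤ m := by
    refine le_csInf ⟨_, hmem ψ hψ⟩ ?_
    rintro _ ⟨φ, hφ, rfl⟩
    have := hcle φ
    rw [hBin, hφ] at this
    linarith
  linarith

/-- A self-adjoint operator with `‖A ψ - a ψ‖ ≥ δ ‖ψ‖` has `a` in its resolvent set. -/
lemma IsSelfAdjoint.notMem_spectrum_of_mul_norm_le {A : V →L[ℝ] V} (hA : IsSelfAdjoint A)
    {a δ : ℝ} (hδ : 0 < δ) (h : ∀ ψ, δ * ‖ψ‖ ≤ ‖A ψ - a • ψ‖) : a ∉ spectrum ℝ A := by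
  rw [spectrum.notMem_iff]
  set D : V →L[ℝ] V := algebraMap ℝ _ a - A with hD
  have hDapp : ∀ ψ, D ψ = a • ψ - A ψ := fun ψ => by simp [hD, Algebra.algebraMap_eq_smul_one]
  have hDsa : ∀ ψ φ, ⟪D ψ, φ⟫_ℝ = ⟪ψ, D φ⟫_ℝ := fun ψ φ => by
    have := hA.isSymmetric ψ φ
    simp only [ContinuousLinearMap.coe_coe] at this
    simp only [hDapp, inner_sub_left, inner_sub_right, inner_smul_left, inner_smul_right, this]
    simp
  have hsq : IsUnit (D ^ 2) := by
    refine ContinuousLinearMap.isUnit_of_forall_le_norm_inner_map _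
      (c := ⟨δ ^ 2, by positivity⟩) (by exact pow_pos hδ 2) fun ψ => ?_
    have e : ⟪(D ^ 2) ψ, ψ⟫_ℝ = ‖D ψ‖ ^ 2 := by
      rw [pow_two, mul_apply_eq_comp, hDsa, real_inner_self_eq_norm_sq]
    have h' : δ * ‖ψ‖ ≤ ‖D ψ‖ := by rw [hDapp, norm_sub_rev]; exact h ψ
    rw [e, Real.norm_of_nonneg (by positivity)]
    change ‖ψ‖ ^ 2 * δ ^ 2 ≤ _
    rw [← mul_pow, mul_comm]
    gcongr
  exact (isUnit_pow_iff two_ne_zero).1 hsq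

end Spectral

section Orbit

variable {X : Type*} [TopologicalSpace X] (T : X ≃ₜ X)

lemma Homeomorph.toEquiv_zpow_natCast_apply (k : ℕ) (x : X) :
    (T.toEquiv ^ (k : ℤ)) x = T^[k] x := by
  rw [zpow_natCast]
  exact congrFun (Equiv.Perm.iterate_eq_pow T.toEquiv k).symm x

lemma Homeomorph.toEquiv_zpow_neg_natCast_apply (k : ℕ) (x : X) :
    (T.toEquiv ^ (-(k : ℤ))) x = T.symm^[k] x := by
  rw [zpow_neg, zpow_natCast, ← inv_pow]
  exact congrFun (Equiv.Perm.iterate_eq_pow T.toEquiv⁻¹ k).symm x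

lemma Homeomorph.continuous_toEquiv_zpow (n : ℤ) : Continuous (T.toEquiv ^ n) := by
  obtain ⟨k, rfl | rfl⟩ := n.eq_nat_or_neg
  · exact (T.continuous.iterate k).congr fun x => (T.toEquiv_zpow_natCast_apply k x).symm
  · exact (T.symm.continuous.iterate k).congr
      fun x => (T.toEquiv_zpow_neg_natCast_apply k x).symm

end Orbit

/-- A closed set of full measure for `μ × ν^ℤ` contains `supp μ × (supp ν)^ℤ`. -/
lemma mem_of_isClosed_of_ae_mem_prod {X : Type*} [TopologicalSpace X]
    [MeasurableSpace X] {μ : Measure X}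
    (hfull : ∀ U : Set X, IsOpen U → U.Nonempty → μ U ≠ 0) {ν : Measure ℝ}
    {ν' : Measure (ℤ → ℝ)} [SFinite ν']
    (hν' : ∀ (F : Finset ℤ) (t : ℤ → Set ℝ), (∀ i, MeasurableSet (t i)) →
      ν' {ω | ∀ i ∈ F, ω i ∈ t i} = ∏ i ∈ F, ν (t i))
    {K : Set (X × (ℤ → ℝ))} (hK : IsClosed K) (h : ∀ᵐ p ∂(μ.prod ν'), p ∈ K)
    (x : X) {ω : ℤ → ℝ} (hω : ∀ n, ∀ U ∈ 𝓝 (ω n), ν U ≠ 0) : (x, ω) ∈ K := by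
  by_contra hx
  obtain ⟨U, V, hU, hV, hxU, hωV, hUV⟩ := isOpen_prod_iff.1 hK.isOpen_compl x ω hx
  obtain ⟨F, t, ht, hFt⟩ := isOpen_pi_iff.1 hV ω hωV
  classical
  set t' : ℤ → Set ℝ := fun i => if i ∈ F then t i else Set.univ with ht'
  have hopen : ∀ i, IsOpen (t' i) := fun i => by
    by_cases hi : i ∈ F
    · simpa [ht', hi] using (ht i hi).1
    · simp [ht', hi]
  have hωt : ∀ i, ω i ∈ t' i := fun i => by
    by_cases hi : i ∈ F
    · simpa [ht', hi] using (ht i hi).2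
    · simp [ht', hi]
  have hsub : {ω : ℤ → ℝ | ∀ i ∈ F, ω i ∈ t' i} ⊆ V := fun η hη =>
    hFt fun i hi => by simpa [ht', Finset.mem_coe.1 hi] using hη i hi
  have hVpos : ν' V ≠ 0 := by
    intro h0
    have := measure_mono_null hsub h0
    rw [hν' F t' fun i => (hopen i).measurableSet, Finset.prod_eq_zero_iff] at this
    obtain ⟨i, -, hi⟩ := this
    exact hω i _ ((hopen i).mem_nhds (hωt i)) hi
  have h0 : (μ.prod ν') (U ×ˢ V) = 0 := measure_mono_null hUV h
  rw [Measure.prod_prod, mul_eq_zero] at h0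
  exact h0.elim (hfull U hU ⟨x, hxU⟩) hVpos

/-- Under the product measure `ν^ℤ`, almost every sequence takes its values in `supp ν`. -/
lemma ae_forall_mem_support {ν : Measure ℝ} [IsProbabilityMeasure ν] {ν' : Measure (ℤ → ℝ)}
    [IsProbabilityMeasure ν']
    (hν' : ∀ (F : Finset ℤ) (t : ℤ → Set ℝ), (∀ i, MeasurableSet (t i)) →
      ν' {ω | ∀ i ∈ F, ω i ∈ t i} = ∏ i ∈ F, ν (t i)) :
    ∀ᵐ ω ∂ν', ∀ n, ω n ∈ ν.support := by
  rw [ae_all_iff]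
  intro n
  have hm : MeasurableSet ν.support := Measure.isClosed_support.measurableSet
  have h1 : ν ν.support = 1 := (prob_compl_eq_zero_iff hm).1 Measure.support_mem_ae
  have h := hν' {n} (fun _ => ν.support) fun _ => hm
  simp only [Finset.mem_singleton, forall_eq, Finset.prod_singleton, h1] at h
  exact (prob_compl_eq_zero_iff (measurable_pi_apply n hm)).2 h

lemma lp.sub_smul_apply (φ ψ : lp (fun _ : ℤ => ℝ) 2) (E : ℝ) (n : ℤ) :
    (φ - E • ψ) n = φ n - E * ψ n := rfl

lemma lp.norm_sq_eq_sum_of_support_subset (ψ : lp (fun _ : ℤ => ℝ) 2) (F : Finset ℤ)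
    (h : ∀ n ∉ F, ψ n = 0) : ‖ψ‖ ^ 2 = ∑ n ∈ F, ψ n ^ 2 := by
  rw [← real_inner_self_eq_norm_sq]
  refine (lp.hasSum_inner ψ ψ).unique ?_
  have : ∑ n ∈ F, ψ n ^ 2 = ∑ n ∈ F, inner ℝ (ψ n) (ψ n) :=
    Finset.sum_congr rfl fun n _ => by simp
  rw [this]
  exact hasSum_sum_of_ne_finset_zero fun n hn => by simp [h n hn]

/-- A lower bound for almost every perturbed operator holds for all of them. -/
lemma mul_norm_le_of_ae {X : Type*} [TopologicalSpace X] [MeasurableSpace X] (T : X ≃ₜ X)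
    {μ : Measure X} (hfull : ∀ U : Set X, IsOpen U → U.Nonempty → μ U ≠ 0) (f : C(X, ℝ))
    {ν : Measure ℝ} [IsProbabilityMeasure ν]
    {ν' : Measure (ℤ → ℝ)} [IsProbabilityMeasure ν']
    (hν' : ∀ (F : Finset ℤ) (t : ℤ → Set ℝ), (∀ i, MeasurableSet (t i)) →
      ν' {ω | ∀ i ∈ F, ω i ∈ t i} = ∏ i ∈ F, ν (t i))
    (H' : X → (ℤ → ℝ) → (lp (fun _ : ℤ => ℝ) 2 →L[ℝ] lp (fun _ : ℤ => ℝ) 2))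
    (hH' : ∀ (x : X) (ω : ℤ → ℝ), (∀ n, ω n ∈ ν.support) →
      ∀ (ψ : lp (fun _ : ℤ => ℝ) 2) (n : ℤ),
        (H' x ω ψ) n = ψ (n + 1) + ψ (n - 1) + (f ((T.toEquiv ^ n) x) + ω n) * ψ n)
    {E δ : ℝ} (hδ : 0 ≤ δ)
    (h : ∀ᵐ p ∂(μ.prod ν'), (∀ n, p.2 n ∈ ν.support) ∧
      ∀ ψ, δ * ‖ψ‖ ≤ ‖H' p.1 p.2 ψ - E • ψ‖)
    (x : X) {ω : ℤ → ℝ} (hω : ∀ n, ω n ∈ ν.support) (ψ : lp (fun _ : ℤ => ℝ) 2) :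
    δ * ‖ψ‖ ≤ ‖H' x ω ψ - E • ψ‖ := by
  have hlim := lp.hasSum_single (E := fun _ : ℤ => ℝ) (p := 2) (by simp) ψ
  refine le_of_tendsto_of_tendsto' (hlim.norm.const_mul δ)
    ((((H' x ω).continuous.tendsto _).comp hlim).sub (hlim.const_smul E)).norm fun s => ?_
  simp only [Function.comp_apply]
  set φ : lp (fun _ : ℤ => ℝ) 2 := ∑ i ∈ s, lp.single 2 i (ψ i) with hφ
  have hsupp : ∀ n ∉ s, φ n = 0 := fun n hn => by
    rw [hφ, lp.coeFn_sum, Finset.sum_apply]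
    exact Finset.sum_eq_zero fun i hi => lp.single_apply_ne _ _ _ (by rintro rfl; exact hn hi)
  set F : Finset ℤ := s ∪ (s.image (· + 1) ∪ s.image (· - 1)) with hF
  have key : ∀ (y : X) (η : ℤ → ℝ), (∀ n, η n ∈ ν.support) →
      ‖H' y η φ - E • φ‖ ^ 2 = ∑ n ∈ F,
        (φ (n + 1) + φ (n - 1) + (f ((T.toEquiv ^ n) y) + η n) * φ n - E * φ n) ^ 2 := by
    intro y η hη
    rw [lp.norm_sq_eq_sum_of_support_subset _ F]
    · refine Finset.sum_congr rfl fun n _ => ?_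
      rw [lp.sub_smul_apply, hH' y η hη]
    · intro n hn
      simp only [hF, Finset.mem_union, Finset.mem_image, not_or, not_exists, not_and] at hn
      rw [lp.sub_smul_apply, hH' y η hη, hsupp n hn.1, hsupp (n + 1) fun h => hn.2.2 _ h (by ring),
        hsupp (n - 1) fun h => hn.2.1 _ h (by ring)]
      simp
  have hK : IsClosed {p : X × (ℤ → ℝ) | (δ * ‖φ‖) ^ 2 ≤ ∑ n ∈ F,
      (φ (n + 1) + φ (n - 1) + (f ((T.toEquiv ^ n) p.1) + p.2 n) * φ n - E * φ n) ^ 2} := by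
    refine isClosed_le continuous_const (continuous_finsetSum _ fun n _ => ?_)
    have := T.continuous_toEquiv_zpow n
    fun_prop
  have hmem := mem_of_isClosed_of_ae_mem_prod hfull hν' hK (by
    filter_upwards [h] with p hp
    rw [← key _ _ hp.1]
    gcongr
    exact hp.2 φ) x (ω := ω) fun n U hU =>
      ((Measure.mem_support_iff_forall _).1 (hω n) U hU).ne'
  change (δ * ‖φ‖) ^ 2 ≤ _ at hmem
  rw [← key x _ hω] at hmem
  have hsum : ∑ i ∈ s, E • lp.single 2 i (ψ i) = E • φ := by rw [hφ, Finset.smul_sum]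
  rw [hsum]
  exact le_of_sq_le_sq hmem (norm_nonneg _)

/-- A formal eigenfunction decaying at `-∞` does not become small on the right half-line, if the
energy is in the resolvent set. -/
lemma sq_mul_le_of_formal_eigenfunction
    (A : lp (fun _ : ℤ => ℝ) 2 →L[ℝ] lp (fun _ : ℤ => ℝ) 2) (V φ : ℤ → ℝ)
    (hA : ∀ (ψ : lp (fun _ : ℤ => ℝ) 2) (n : ℤ),
      (A ψ) n = ψ (n + 1) + ψ (n - 1) + V n * ψ n)
    {E δ : ℝ} (hδ : 0 ≤ δ) (hE : ∀ ψ, δ * ‖ψ‖ ≤ ‖A ψ - E • ψ‖)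
    (hφ : ∀ n, φ (n + 1) + φ (n - 1) + V n * φ n = E * φ n)
    (hlim : Filter.Tendsto (fun M : ℕ => φ (-(M : ℤ))) Filter.atTop (𝓝 0))
    {k : ℤ} (hk : 1 ≤ k) :
    δ ^ 2 * (φ 0 ^ 2 + φ (-1) ^ 2) ≤ φ k ^ 2 + φ (k - 1) ^ 2 := by
  have key : ∀ M : ℕ, δ ^ 2 * (φ 0 ^ 2 + φ (-1) ^ 2) ≤
      φ k ^ 2 + φ (k - 1) ^ 2 +
        (φ (-((M + 2 : ℕ) : ℤ)) ^ 2 + φ (-((M + 1 : ℕ) : ℤ)) ^ 2) := by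
    intro M
    have e₁ : (-((M + 2 : ℕ) : ℤ)) = -M - 2 := by push_cast; ring
    have e₂ : (-((M + 1 : ℕ) : ℤ)) = -M - 1 := by push_cast; ring
    rw [e₁, e₂]
    set I : Finset ℤ := Finset.Icc (-M - 1) (k - 1) with hI
    set ψ : lp (fun _ : ℤ => ℝ) 2 := ∑ i ∈ I, lp.single 2 i (φ i) with hψ
    have hψn : ∀ n, ψ n = if n ∈ I then φ n else 0 := fun n => by
      rw [hψ, lp.coeFn_sum, Finset.sum_apply]
      split_ifs with hn
      · rw [Finset.sum_eq_single_of_mem n hn fun i _ hi => lp.single_apply_ne _ _ _ hi.symm,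
          lp.single_apply_self]
      · exact Finset.sum_eq_zero fun i hi =>
          lp.single_apply_ne _ _ _ (by rintro rfl; exact hn hi)
    have hres : ∀ n, (A ψ - E • ψ) n = ψ (n + 1) + ψ (n - 1) + V n * ψ n - E * ψ n :=
      fun n => by rw [lp.sub_smul_apply, hA]
    set F : Finset ℤ := {-(M : ℤ) - 2, -(M : ℤ) - 1, k - 1, k} with hF
    have hnormψ : φ 0 ^ 2 + φ (-1) ^ 2 ≤ ‖ψ‖ ^ 2 := by
      rw [lp.norm_sq_eq_sum_of_support_subset ψ I fun n hn => by rw [hψn, if_neg hn]]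
      have hsub : ({0, -1} : Finset ℤ) ⊆ I := by
        intro n hn
        simp only [Finset.mem_insert, Finset.mem_singleton] at hn
        rw [hI, Finset.mem_Icc]
        omega
      calc φ 0 ^ 2 + φ (-1) ^ 2 = ∑ n ∈ ({0, -1} : Finset ℤ), φ n ^ 2 := by
            rw [Finset.sum_insert (by simp), Finset.sum_singleton]
        _ = ∑ n ∈ ({0, -1} : Finset ℤ), ψ n ^ 2 :=
            Finset.sum_congr rfl fun n hn => by rw [hψn, if_pos (hsub hn)]
        _ ≤ _ := Finset.sum_le_sum_of_subset_of_nonneg hsub fun _ _ _ => sq_nonneg _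
    have hin : ∀ n, -(M : ℤ) - 1 ≤ n → n ≤ k - 1 → ψ n = φ n := fun n h₁ h₂ => by
      rw [hψn, if_pos (Finset.mem_Icc.2 ⟨h₁, h₂⟩)]
    have hout : ∀ n, n < -(M : ℤ) - 1 ∨ k - 1 < n → ψ n = 0 := fun n h => by
      rw [hψn, if_neg (by rw [hI, Finset.mem_Icc]; omega)]
    have r₁ : (A ψ - E • ψ) (-M - 2) = φ (-M - 1) := by
      rw [hres, hin (-M - 2 + 1) (by omega) (by omega), hout (-M - 2 - 1) (by omega),
        hout (-M - 2) (by omega)]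
      ring_nf
    have r₂ : (A ψ - E • ψ) (-M - 1) = -φ (-M - 2) := by
      have h := hφ (-M - 1)
      rw [show (-(M : ℤ) - 1 - 1) = -M - 2 by ring] at h
      rw [hres, hin (-M - 1 + 1) (by omega) (by omega), hout (-M - 1 - 1) (by omega),
        hin (-M - 1) (by omega) (by omega)]
      linarith
    have r₃ : (A ψ - E • ψ) (k - 1) = -φ k := by
      have h := hφ (k - 1)
      rw [show k - 1 + 1 = k by ring] at h
      rw [hres, hout (k - 1 + 1) (by omega), hin (k - 1 - 1) (by omega) (by omega),
        hin (k - 1) (by omega) (by omega)]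
      linarith
    have r₄ : (A ψ - E • ψ) k = φ (k - 1) := by
      rw [hres, hout (k + 1) (by omega), hin (k - 1) (by omega) (by omega),
        hout k (by omega)]
      ring
    have hnormres : ‖A ψ - E • ψ‖ ^ 2 = φ k ^ 2 + φ (k - 1) ^ 2 +
        (φ (-M - 2) ^ 2 + φ (-M - 1) ^ 2) := by
      rw [lp.norm_sq_eq_sum_of_support_subset _ F]
      · rw [hF, Finset.sum_insert, Finset.sum_insert, Finset.sum_insert, Finset.sum_singleton,
          r₁, r₂, r₃, r₄]
        · ring
        all_goals
          simp only [Finset.mem_insert, Finset.mem_singleton, not_or]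
          omega
      · intro n hn
        simp only [hF, Finset.mem_insert, Finset.mem_singleton, not_or] at hn
        rw [hres]
        by_cases h : -(M : ℤ) - 1 ≤ n ∧ n ≤ k - 1
        · rw [hin (n + 1) (by omega) (by omega), hin (n - 1) (by omega) (by omega),
            hin n h.1 h.2]
          linarith [hφ n]
        · rw [hout (n + 1) (by omega), hout (n - 1) (by omega), hout n (by omega)]
          ring
    rw [← hnormres]
    calc δ ^ 2 * (φ 0 ^ 2 + φ (-1) ^ 2) ≤ δ ^ 2 * ‖ψ‖ ^ 2 := by gcongr
      _ = (δ * ‖ψ‖) ^ 2 := by ring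
      _ ≤ _ := by gcongr; exact hE ψ
  have hl : Filter.Tendsto (fun M : ℕ => φ k ^ 2 + φ (k - 1) ^ 2 +
      (φ (-((M + 2 : ℕ) : ℤ)) ^ 2 + φ (-((M + 1 : ℕ) : ℤ)) ^ 2)) Filter.atTop
      (𝓝 (φ k ^ 2 + φ (k - 1) ^ 2 + (0 ^ 2 + 0 ^ 2))) :=
    ((((hlim.comp (Filter.tendsto_add_atTop_nat 2))).pow 2).add
      (((hlim.comp (Filter.tendsto_add_atTop_nat 1))).pow 2)).const_add _
  simpa using ge_of_tendsto' hl key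

lemma norm_sq_le_sq_add_sq (u : Fin 2 → ℝ) : ‖u‖ ^ 2 ≤ u 0 ^ 2 + u 1 ^ 2 := by
  have : ‖u‖ ≤ √(u 0 ^ 2 + u 1 ^ 2) := by
    refine (pi_norm_le_iff_of_nonneg (Real.sqrt_nonneg _)).2 fun i => ?_
    refine Real.abs_le_sqrt ?_
    fin_cases i <;> simp [sq_nonneg]
  calc ‖u‖ ^ 2 ≤ √(u 0 ^ 2 + u 1 ^ 2) ^ 2 := by gcongr
    _ = _ := Real.sq_sqrt (by positivity)

lemma cocIterN_succ_eq_mul {X : Type*} (T : X → X) (A : X → SL2) (k : ℕ) (x : X) :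
    cocIterN T A (k + 1) x = cocIterN T A k (T x) * A x := by
  induction k with
  | zero => simp [cocIterN]
  | succ k ih => rw [cocIterN, ih, cocIterN, mul_assoc, Function.iterate_succ_apply]

lemma cocIterZ_neg_natCast {X : Type*} [TopologicalSpace X] (T : X ≃ₜ X) (A : X → SL2) (k : ℕ)
    (x : X) : cocIterZ T A (-(k : ℤ)) x = (cocIterN T A k (T.symm^[k] x))⁻¹ := by
  rcases k with _ | k
  · simp [cocIterZ, cocIterN]
  · rw [cocIterZ, if_neg (by omega)]
    simp

lemma cocIterZ_neg_natCast_eq_mul {X : Type*} [TopologicalSpace X] (T : X ≃ₜ X) (A : X → SL2)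
    (k : ℕ) (x : X) :
    cocIterZ T A (-(k : ℤ)) x =
      A (T.symm^[k + 1] x) * cocIterZ T A (-((k + 1 : ℕ) : ℤ)) x := by
  rw [cocIterZ_neg_natCast, cocIterZ_neg_natCast, cocIterN_succ_eq_mul, mul_inv_rev,
    mul_inv_cancel_left, Function.iterate_succ_apply' _ k x, T.apply_symm_apply]

/-- Along an unstable direction of the cocycle at energy `E - v`, the iterates of the cocycle at
energy `E - v'` are bounded below, if `E` is in the resolvent set of the operator whose potential
is perturbed by `v` on the left and by `v'` on the right half-line. -/
lemma sq_mul_norm_sq_le_of_isUnstableSection {X : Type*} [TopologicalSpace X] (T : X ≃ₜ X)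
    (f : C(X, ℝ)) {E v v' δ : ℝ} (hδ : 0 ≤ δ) {d : C(X, RP1)}
    (hd : IsUnstableSection T (schrodingerCocycle f (E - v)) d) (y : X)
    (A : lp (fun _ : ℤ => ℝ) 2 →L[ℝ] lp (fun _ : ℤ => ℝ) 2)
    (hA : ∀ (ψ : lp (fun _ : ℤ => ℝ) 2) (n : ℤ), (A ψ) n =
      ψ (n + 1) + ψ (n - 1) + (f ((T.toEquiv ^ n) y) + if n < 0 then v else v') * ψ n)
    (hE : ∀ ψ, δ * ‖ψ‖ ≤ ‖A ψ - E • ψ‖)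
    {u : Fin 2 → ℝ} (hu : u ≠ 0) (hud : Projectivization.mk ℝ u hu = d y)
    {k : ℕ} (hk : 1 ≤ k) :
    δ ^ 2 * ‖u‖ ^ 2 ≤ 2 * ‖(cocIterN T (schrodingerCocycle f (E - v')) k y :
      Matrix (Fin 2) (Fin 2) ℝ).mulVec u‖ ^ 2 := by
  obtain ⟨-, C, hC, l, hl, hdecay⟩ := hd
  set B := schrodingerCocycle f (E - v) with hB
  set B' := schrodingerCocycle f (E - v') with hB'
  set Φ : ℤ → Fin 2 → ℝ := fun n =>
    if 0 ≤ n then (cocIterN T B' n.toNat y : Matrix (Fin 2) (Fin 2) ℝ).mulVec u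
    else (cocIterZ T B n y : Matrix (Fin 2) (Fin 2) ℝ).mulVec u with hΦ
  have hΦnat : ∀ n : ℕ, Φ n = (cocIterN T B' n y : Matrix (Fin 2) (Fin 2) ℝ).mulVec u :=
    fun n => by simp [hΦ]
  have hΦneg : ∀ n : ℕ,
      Φ (-(n : ℤ)) = (cocIterZ T B (-(n : ℤ)) y : Matrix (Fin 2) (Fin 2) ℝ).mulVec u := by
    rintro (_ | n)
    · rw [cocIterZ_neg_natCast]
      simpa [cocIterN] using hΦnat 0
    · simp only [hΦ]
      rw [if_neg (by omega)]
  have hΦ0 : Φ 0 = u := by simpa [cocIterN] using hΦnat 0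
  have hrec : ∀ n : ℤ, Φ (n + 1) = (schrodingerCocycle f (E - if n < 0 then v else v')
      ((T.toEquiv ^ n) y) : Matrix (Fin 2) (Fin 2) ℝ).mulVec (Φ n) := by
    intro n
    rcases lt_or_ge n 0 with hn | hn
    · obtain ⟨j, rfl⟩ : ∃ j : ℕ, n = -((j + 1 : ℕ) : ℤ) := ⟨(-n).toNat - 1, by omega⟩
      rw [if_pos hn, show -((j + 1 : ℕ) : ℤ) + 1 = -(j : ℤ) by push_cast; ring, hΦneg, hΦneg,
        T.toEquiv_zpow_neg_natCast_apply, cocIterZ_neg_natCast_eq_mul, Matrix.mulVec_mulVec,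
        Matrix.SpecialLinearGroup.coe_mul]
    · obtain ⟨j, rfl⟩ := Int.eq_ofNat_of_zero_le hn
      rw [if_neg hn.not_gt, show ((j : ℤ) + 1) = ((j + 1 : ℕ) : ℤ) by push_cast; ring, hΦnat,
        hΦnat, T.toEquiv_zpow_natCast_apply, cocIterN, Matrix.mulVec_mulVec,
        Matrix.SpecialLinearGroup.coe_mul]
  have hrec₀ : ∀ n, Φ (n + 1) 0 =
      (E - (if n < 0 then v else v') - f ((T.toEquiv ^ n) y)) * Φ n 0 - Φ n 1 := fun n => by
    rw [hrec]
    simp [schrodingerCocycle, Matrix.mulVec, dotProduct, Fin.sum_univ_two]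
    ring
  have hrec₁ : ∀ n, Φ (n + 1) 1 = Φ n 0 := fun n => by
    rw [hrec]
    simp [schrodingerCocycle, Matrix.mulVec, dotProduct, Fin.sum_univ_two]
  have hprev : ∀ n, Φ n 1 = Φ (n - 1) 0 := fun n => by
    have := hrec₁ (n - 1)
    rwa [sub_add_cancel] at this
  have hlim : Filter.Tendsto (fun M : ℕ => Φ (-(M : ℤ)) 0) Filter.atTop (𝓝 0) := by
    have hg : Filter.Tendsto (fun n : ℕ => C * (l ^ n)⁻¹ * ‖u‖) Filter.atTop (𝓝 0) := by
      have := ((tendsto_pow_atTop_atTop_of_one_lt hl).inv_tendsto_atTop.const_mul C).mul_const ‖u‖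
      simpa using this
    refine squeeze_zero_norm (fun n => ?_) hg
    refine (norm_le_pi_norm _ 0).trans ?_
    rw [hΦneg]
    exact hdecay y n u hu hud
  have key := sq_mul_le_of_formal_eigenfunction A
    (fun n => f ((T.toEquiv ^ n) y) + if n < 0 then v else v') (fun n => Φ n 0) hA hδ hE
    (fun n => by
      have h₁ := hrec₀ n
      have h₂ := hprev n
      simp only [h₁, ← h₂]
      ring) hlim (k := k) (by exact_mod_cast hk)
  simp only [← hprev] at key
  rw [show Φ (-1) 0 = Φ 0 1 by rw [hprev]; rfl, hΦ0, hΦnat] at key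
  set w := (cocIterN T B' k y : Matrix (Fin 2) (Fin 2) ℝ).mulVec u
  have hw : ∀ i, w i ^ 2 ≤ ‖w‖ ^ 2 := fun i =>
    sq_le_sq' (neg_le_of_abs_le (norm_le_pi_norm w i)) (le_of_abs_le (norm_le_pi_norm w i))
  calc δ ^ 2 * ‖u‖ ^ 2 ≤ δ ^ 2 * (u 0 ^ 2 + u 1 ^ 2) := by
        gcongr
        exact norm_sq_le_sq_add_sq u
    _ ≤ w 0 ^ 2 + w 1 ^ 2 := key
    _ ≤ _ := by linarith [hw 0, hw 1]

section ProjectiveLine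

open Matrix

/-- The line spanned by a nonzero vector, with a junk value at `0`. -/
def RP1.span (v : Fin 2 → ℝ) : RP1 :=
  if h : v ≠ 0 then Projectivization.mk ℝ v h else Projectivization.mk ℝ (fun _ => 1) (by
    intro h
    simpa using congrFun h 0)

lemma RP1.span_of_ne_zero {v : Fin 2 → ℝ} (h : v ≠ 0) :
    RP1.span v = Projectivization.mk ℝ v h := dif_pos h

lemma RP1.span_smul {a : ℝ} (ha : a ≠ 0) {v : Fin 2 → ℝ} (h : v ≠ 0) :
    RP1.span (a • v) = RP1.span v := by
  rw [span_of_ne_zero h, span_of_ne_zero (smul_ne_zero ha h), Projectivization.mk_eq_mk_iff']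
  exact ⟨a, rfl⟩

lemma RP1.span_rep (p : RP1) : RP1.span p.rep = p := by
  rw [span_of_ne_zero p.rep_nonzero, p.mk_rep]

lemma RP1.exists_smul_rep_span {v : Fin 2 → ℝ} (h : v ≠ 0) :
    ∃ a : ℝ, a ≠ 0 ∧ a • v = (RP1.span v).rep := by
  rw [span_of_ne_zero h]
  obtain ⟨a, ha⟩ := Projectivization.exists_smul_eq_mk_rep ℝ v h
  exact ⟨a, a.ne_zero, ha⟩

lemma RP1.continuousAt_span {v : Fin 2 → ℝ} (h : v ≠ 0) : ContinuousAt RP1.span v := by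
  have hopen : IsOpen {v : Fin 2 → ℝ | v ≠ 0} := isOpen_ne
  refine ContinuousOn.continuousAt ?_ (hopen.mem_nhds h)
  rw [continuousOn_iff_continuous_domRestrict]
  have : Continuous (fun v : {v : Fin 2 → ℝ // v ≠ 0} => Projectivization.mk ℝ v.1 v.2) :=
    continuous_quotient_mk'
  exact this.congr fun v => (span_of_ne_zero v.2).symm

/-- The orthogonal projection onto a line in `ℝ²`. -/
def RP1.orthProj (p : RP1) : Matrix (Fin 2) (Fin 2) ℝ :=
  (p.rep ⬝ᵥ p.rep)⁻¹ • vecMulVec p.rep p.rep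

lemma RP1.orthProj_span {v : Fin 2 → ℝ} (h : v ≠ 0) :
    (RP1.span v).orthProj = (v ⬝ᵥ v)⁻¹ • vecMulVec v v := by
  obtain ⟨a, ha, hav⟩ := exists_smul_rep_span h
  have hv : v ⬝ᵥ v ≠ 0 := mt dotProduct_self_eq_zero.1 h
  rw [orthProj, ← hav]
  ext i j
  simp only [dotProduct_smul, smul_dotProduct, smul_eq_mul, Matrix.smul_apply, vecMulVec_apply,
    Pi.smul_apply]
  field_simp

lemma RP1.continuous_orthProj : Continuous RP1.orthProj := by
  refine continuous_coinduced_dom.2 ?_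
  have : Continuous fun v : {v : Fin 2 → ℝ // v ≠ 0} =>
      ((v : Fin 2 → ℝ) ⬝ᵥ (v : Fin 2 → ℝ))⁻¹ •
        vecMulVec (v : Fin 2 → ℝ) (v : Fin 2 → ℝ) := by
    refine Continuous.smul
      (Continuous.inv₀ (continuous_subtype_val.dotProduct continuous_subtype_val)
        fun v => mt dotProduct_self_eq_zero.1 v.2)
      (continuous_subtype_val.matrix_vecMulVec continuous_subtype_val)
  refine this.congr fun v => ?_
  rw [← orthProj_span v.2, span_of_ne_zero v.2]
  rfl

/-- The image of a line under a matrix. -/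
def RP1.map (M : Matrix (Fin 2) (Fin 2) ℝ) (p : RP1) : RP1 := RP1.span (M *ᵥ p.rep)

lemma RP1.map_span (M : Matrix (Fin 2) (Fin 2) ℝ) {v : Fin 2 → ℝ} (hv : v ≠ 0)
    (h : M *ᵥ v ≠ 0) : RP1.map M (RP1.span v) = RP1.span (M *ᵥ v) := by
  obtain ⟨a, ha, hav⟩ := exists_smul_rep_span hv
  rw [map, ← hav, mulVec_smul, span_smul ha h]

lemma RP1.continuous_map {Z : Type*} [TopologicalSpace Z] {M : Z → Matrix (Fin 2) (Fin 2) ℝ}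
    {p : Z → RP1} (hM : Continuous M) (hp : Continuous p) (h : ∀ z, M z *ᵥ (p z).rep ≠ 0) :
    Continuous fun z => RP1.map (M z) (p z) := by
  rw [continuous_iff_continuousAt]
  intro z₀
  obtain ⟨j, hj⟩ : ∃ j, (p z₀).rep j ≠ 0 := Function.ne_iff.1 (p z₀).rep_nonzero
  set w : Z → Fin 2 → ℝ := fun z => (p z).orthProj.col j with hw
  have hwc : Continuous w := by
    have := RP1.continuous_orthProj.comp hp
    exact continuous_pi fun i => this.matrix_elem i j
  have hww : ∀ z, w z = (((p z).rep ⬝ᵥ (p z).rep)⁻¹ * (p z).rep j) • (p z).rep := fun z => by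
    ext i
    simp only [hw, orthProj, Matrix.col_apply, Matrix.smul_apply, vecMulVec_apply, smul_eq_mul,
      Pi.smul_apply]
    ring
  have hc : ∀ z, (p z).rep j ≠ 0 → ((p z).rep ⬝ᵥ (p z).rep)⁻¹ * (p z).rep j ≠ 0 := fun z hz =>
    mul_ne_zero (inv_ne_zero (mt dotProduct_self_eq_zero.1 (p z).rep_nonzero)) hz
  have hwz₀ : w z₀ ≠ 0 := by
    rw [hww]
    exact smul_ne_zero (hc z₀ hj) (p z₀).rep_nonzero
  have hMw : M z₀ *ᵥ w z₀ ≠ 0 := by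
    rw [hww, mulVec_smul]
    exact smul_ne_zero (hc z₀ hj) (h z₀)
  have hev : ∀ᶠ z in 𝓝 z₀, RP1.span (M z *ᵥ w z) = RP1.map (M z) (p z) := by
    filter_upwards [hwc.continuousAt.eventually_ne hwz₀] with z hz
    have hz' : ((p z).rep ⬝ᵥ (p z).rep)⁻¹ * (p z).rep j ≠ 0 := fun h0 => hz (by
      rw [hww, h0, zero_smul])
    rw [map, hww, mulVec_smul, span_smul hz' (h z)]
  refine ContinuousAt.congr ?_ hev
  exact (RP1.continuousAt_span hMw).comp (f := fun z => M z *ᵥ w z)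
    (hM.matrix_mulVec hwc).continuousAt

lemma SL2.mulVec_ne_zero (A : SL2) {v : Fin 2 → ℝ} (hv : v ≠ 0) :
    (A : Matrix (Fin 2) (Fin 2) ℝ) *ᵥ v ≠ 0 := by
  intro h
  refine hv (Matrix.eq_zero_of_mulVec_eq_zero (M := (A : Matrix (Fin 2) (Fin 2) ℝ)) ?_ h)
  simp

lemma SL2act_eq_map (A : SL2) (p : RP1) :
    SL2act A p = RP1.map (A : Matrix (Fin 2) (Fin 2) ℝ) p := by
  conv_lhs => rw [← p.mk_rep]
  rw [RP1.map, RP1.span_of_ne_zero (SL2.mulVec_ne_zero A p.rep_nonzero)]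
  rfl

/-- Two continuous families of lines in `ℝ²` which are nowhere orthogonal are homotopic. -/
lemma RP1.homotopic_of_dotProduct_ne_zero {X : Type*} [TopologicalSpace X] {p q : C(X, RP1)}
    (h : ∀ x, (q x).rep ⬝ᵥ (p x).rep ≠ 0) : p.Homotopic q := by
  set M : unitInterval × X → Matrix (Fin 2) (Fin 2) ℝ := fun z =>
    (1 - (z.1 : ℝ)) • (1 : Matrix (Fin 2) (Fin 2) ℝ) + (z.1 : ℝ) • (q z.2).orthProj with hM
  have hMc : Continuous M := by
    have := RP1.continuous_orthProj.comp (q.continuous.comp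
      (continuous_snd : Continuous (Prod.snd : unitInterval × X → X)))
    have h₁ : Continuous fun z : unitInterval × X => (z.1 : ℝ) := by fun_prop
    exact ((continuous_const.sub h₁).smul continuous_const).add (h₁.smul this)
  have hMv : ∀ z, M z *ᵥ (p z.2).rep = (1 - (z.1 : ℝ)) • (p z.2).rep +
      ((z.1 : ℝ) * (((q z.2).rep ⬝ᵥ (q z.2).rep)⁻¹ * ((q z.2).rep ⬝ᵥ (p z.2).rep))) •
        (q z.2).rep := fun z => by
    simp only [hM, orthProj, add_mulVec, smul_mulVec, one_mulVec, vecMulVec_mulVec, op_smul_eq_smul,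
      smul_smul, mul_assoc]
  have hpos : ∀ r : RP1, 0 < r.rep ⬝ᵥ r.rep := fun r =>
    lt_of_le_of_ne (Finset.sum_nonneg fun _ _ => mul_self_nonneg _)
      (Ne.symm (mt dotProduct_self_eq_zero.1 r.rep_nonzero))
  have hne : ∀ z, M z *ᵥ (p z.2).rep ≠ 0 := by
    intro z h0
    have h₁ := congrArg (fun v => (p z.2).rep ⬝ᵥ v) h0
    simp only [hMv, dotProduct_add, dotProduct_smul, smul_eq_mul, dotProduct_zero] at h₁
    have ht₀ : 0 ≤ (z.1 : ℝ) := z.1.2.1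
    have ht₁ : 0 ≤ 1 - (z.1 : ℝ) := sub_nonneg.2 z.1.2.2
    have a₁ := hpos (p z.2)
    have a₂ : 0 < ((q z.2).rep ⬝ᵥ (q z.2).rep)⁻¹ * ((q z.2).rep ⬝ᵥ (p z.2).rep) *
        ((q z.2).rep ⬝ᵥ (p z.2).rep) := by
      rw [mul_assoc, ← pow_two]
      exact mul_pos (inv_pos.2 (hpos _)) (by have := h z.2; positivity)
    rw [dotProduct_comm (p z.2).rep (q z.2).rep, mul_assoc (z.1 : ℝ)] at h₁
    rcases ht₀.eq_or_lt with ht | ht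
    · rw [← ht] at h₁
      linarith
    · linarith [mul_nonneg ht₁ a₁.le, mul_pos ht a₂]
  refine ⟨⟨⟨fun z => RP1.map (M z) (p z.2),
    RP1.continuous_map hMc (p.continuous.comp continuous_snd) hne⟩, fun x => ?_, fun x => ?_⟩⟩
  · change RP1.span _ = _
    rw [hMv]
    simpa using RP1.span_rep (p x)
  · change RP1.span _ = _
    rw [hMv]
    have : ((q x).rep ⬝ᵥ (q x).rep)⁻¹ * ((q x).rep ⬝ᵥ (p x).rep) ≠ 0 :=
      mul_ne_zero (inv_ne_zero (hpos _).ne') (h x)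
    simpa using (RP1.span_smul this (q x).rep_nonzero).trans (RP1.span_rep (q x))

end ProjectiveLine

section Homotopy

open Matrix

lemma SL2.norm_mulVec_mul_norm_mulVec_le (A : SL2) {u w : Fin 2 → ℝ}
    (h : ((A : Matrix (Fin 2) (Fin 2) ℝ) *ᵥ u) ⬝ᵥ ((A : Matrix (Fin 2) (Fin 2) ℝ) *ᵥ w) = 0) :
    ‖(A : Matrix (Fin 2) (Fin 2) ℝ) *ᵥ u‖ * ‖(A : Matrix (Fin 2) (Fin 2) ℝ) *ᵥ w‖ ≤
      2 * ‖u‖ * ‖w‖ := by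
  set a := (A : Matrix (Fin 2) (Fin 2) ℝ) *ᵥ u with ha
  set b := (A : Matrix (Fin 2) (Fin 2) ℝ) *ᵥ w with hb
  have hdet : a 0 * b 1 - a 1 * b 0 = u 0 * w 1 - u 1 * w 0 := by
    have hA := A.det_coe
    rw [det_fin_two] at hA
    simp only [ha, hb, mulVec, dotProduct, Fin.sum_univ_two]
    linear_combination (u 0 * w 1 - u 1 * w 0) * hA
  have hab : a 0 * b 0 + a 1 * b 1 = 0 := by
    simpa only [dotProduct, Fin.sum_univ_two] using h
  have hle : |u 0 * w 1 - u 1 * w 0| ≤ 2 * ‖u‖ * ‖w‖ := by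
    have hn : ∀ (z : Fin 2 → ℝ) (i : Fin 2), |z i| ≤ ‖z‖ := fun z i => norm_le_pi_norm z i
    calc |u 0 * w 1 - u 1 * w 0| ≤ |u 0 * w 1| + |u 1 * w 0| := abs_sub _ _
      _ = |u 0| * |w 1| + |u 1| * |w 0| := by rw [abs_mul, abs_mul]
      _ ≤ ‖u‖ * ‖w‖ + ‖u‖ * ‖w‖ := by
        gcongr <;> apply hn
      _ = _ := by ring
  refine le_trans ?_ hle
  refine le_of_sq_le_sq ?_ (abs_nonneg _)
  rw [sq_abs, ← hdet]
  calc (‖a‖ * ‖b‖) ^ 2 = ‖a‖ ^ 2 * ‖b‖ ^ 2 := by ring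
    _ ≤ (a 0 ^ 2 + a 1 ^ 2) * (b 0 ^ 2 + b 1 ^ 2) := by
      gcongr <;> exact norm_sq_le_sq_add_sq _
    _ = (a 0 * b 1 - a 1 * b 0) ^ 2 + (a 0 * b 0 + a 1 * b 1) ^ 2 := by ring
    _ = _ := by rw [hab]; ring

lemma SL2act_mul (A B : SL2) (p : RP1) : SL2act (A * B) p = SL2act A (SL2act B p) := by
  have hB := SL2.mulVec_ne_zero B p.rep_nonzero
  have hAB : ((A * B : SL2) : Matrix (Fin 2) (Fin 2) ℝ) =
    (A : Matrix (Fin 2) (Fin 2) ℝ) * (B : Matrix (Fin 2) (Fin 2) ℝ) := rfl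
  rw [SL2act_eq_map, SL2act_eq_map A, SL2act_eq_map B]
  change RP1.span _ = RP1.map _ (RP1.span _)
  rw [RP1.map_span _ hB (SL2.mulVec_ne_zero A hB), mulVec_mulVec, hAB]

variable {X : Type*} [TopologicalSpace X] (T : X ≃ₜ X)

lemma IsInvariantSection.map_cocIterN {T : X ≃ₜ X} {A : X → SL2} {d : C(X, RP1)}
    (hd : IsInvariantSection T A d) (k : ℕ) (x : X) :
    RP1.map (cocIterN T A k x : Matrix (Fin 2) (Fin 2) ℝ) (d x) = d (T^[k] x) := by
  rw [← SL2act_eq_map]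
  induction k with
  | zero =>
    rw [SL2act_eq_map]
    simpa [cocIterN, RP1.map] using RP1.span_rep (d x)
  | succ k ih => rw [cocIterN, SL2act_mul, ih, hd, Function.iterate_succ_apply']

lemma continuous_cocIterN_schrodingerCocycle (f : C(X, ℝ)) {Z : Type*} [TopologicalSpace Z]
    {e : Z → ℝ} {y : Z → X} (he : Continuous e) (hy : Continuous y) (k : ℕ) :
    Continuous fun z =>
      (cocIterN T (schrodingerCocycle f (e z)) k (y z) : Matrix (Fin 2) (Fin 2) ℝ) := by
  induction k with
  | zero => exact continuous_const
  | succ k ih =>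
    simp only [cocIterN]
    refine Continuous.matrix_mul ?_ ih
    have hT : Continuous fun z => T^[k] (y z) := (T.continuous.iterate k).comp hy
    refine continuous_matrix fun i j => ?_
    fin_cases i <;> fin_cases j <;> simp [schrodingerCocycle] <;> fun_prop

/-- Unstable sections at energies `E - v` and `E - v'` are homotopic if `E` is, uniformly in the
base point, in the resolvent set of the operators whose potential is perturbed by `v` on the left
and by `v'` on the right half-line. -/
lemma homotopic_of_isUnstableSection (f : C(X, ℝ)) {E v v' δ : ℝ} (hδ : 0 < δ) {d d' : C(X, RP1)}
    (hd : IsUnstableSection T (schrodingerCocycle f (E - v)) d)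
    (hd' : IsUnstableSection T (schrodingerCocycle f (E - v')) d')
    (A : X → lp (fun _ : ℤ => ℝ) 2 →L[ℝ] lp (fun _ : ℤ => ℝ) 2)
    (hA : ∀ (y : X) (ψ : lp (fun _ : ℤ => ℝ) 2) (n : ℤ), (A y ψ) n =
      ψ (n + 1) + ψ (n - 1) + (f ((T.toEquiv ^ n) y) + if n < 0 then v else v') * ψ n)
    (hE : ∀ y ψ, δ * ‖ψ‖ ≤ ‖A y ψ - E • ψ‖) :
    d.Homotopic d' := by
  obtain ⟨hinv', C, hC, l, hl, hdecay⟩ := hd'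
  obtain ⟨k, hk, hk₁⟩ : ∃ k : ℕ, 4 * C / δ < l ^ k ∧ 1 ≤ k :=
    (((tendsto_pow_atTop_atTop_of_one_lt hl).eventually_gt_atTop _).and
      (Filter.eventually_ge_atTop 1)).exists
  have hTk : Continuous (T.symm^[k]) := T.symm.continuous.iterate k
  have hTT : ∀ x, T^[k] (T.symm^[k] x) = x :=
    Function.LeftInverse.iterate (fun x => T.apply_symm_apply x) k
  set G : unitInterval × X → RP1 := fun z =>
    RP1.map (cocIterN T (schrodingerCocycle f (E - ((1 - (z.1 : ℝ)) * v + z.1 * v'))) k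
      (T.symm^[k] z.2) : Matrix (Fin 2) (Fin 2) ℝ) (d (T.symm^[k] z.2)) with hG
  have hGc : Continuous G :=
    RP1.continuous_map
      (continuous_cocIterN_schrodingerCocycle T f (by fun_prop) (hTk.comp continuous_snd) k)
      (d.continuous.comp (hTk.comp continuous_snd))
      fun z => SL2.mulVec_ne_zero _ (Projectivization.rep_nonzero _)
  set g : C(X, RP1) := ⟨fun x => G (1, x), hGc.comp (by fun_prop)⟩ with hg
  have h₁ : d.Homotopic g := by
    refine ⟨⟨⟨G, hGc⟩, fun x => ?_, fun x => rfl⟩⟩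
    have := hd.1.map_cocIterN k (T.symm^[k] x)
    rw [hTT] at this
    simpa [hG] using this
  refine h₁.trans (RP1.homotopic_of_dotProduct_ne_zero fun x hx => ?_)
  set y := T.symm^[k] x with hy
  set M := cocIterN T (schrodingerCocycle f (E - v')) k y with hM
  have hgx : g x = RP1.span ((M : Matrix (Fin 2) (Fin 2) ℝ) *ᵥ (d y).rep) := by
    simp [hg, hG, RP1.map, ← hy, ← hM]
  have hd'x : d' x = RP1.span ((M : Matrix (Fin 2) (Fin 2) ℝ) *ᵥ (d' y).rep) := by
    have := hinv'.map_cocIterN k y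
    rw [hy, hTT] at this
    exact this.symm
  have hu := SL2.mulVec_ne_zero M (d y).rep_nonzero
  have hw := SL2.mulVec_ne_zero M (d' y).rep_nonzero
  obtain ⟨a, ha, hag⟩ := RP1.exists_smul_rep_span hu
  obtain ⟨b, hb, hbd⟩ := RP1.exists_smul_rep_span hw
  rw [← hgx] at hag
  rw [← hd'x] at hbd
  have horth : ((M : Matrix (Fin 2) (Fin 2) ℝ) *ᵥ (d y).rep) ⬝ᵥ
      ((M : Matrix (Fin 2) (Fin 2) ℝ) *ᵥ (d' y).rep) = 0 := by
    rw [← hag, ← hbd, smul_dotProduct, dotProduct_smul, smul_eq_mul, smul_eq_mul,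
      dotProduct_comm] at hx
    simpa [ha, hb] using hx
  have hle := SL2.norm_mulVec_mul_norm_mulVec_le M horth
  have hlow := sq_mul_norm_sq_le_of_isUnstableSection T f hδ.le hd y (A y) (hA y) (hE y)
    (d y).rep_nonzero (d y).mk_rep hk₁
  have hup := hdecay x k _ hw (by rw [hd'x, RP1.span_of_ne_zero hw])
  have hinv : ((M⁻¹ : SL2) : Matrix (Fin 2) (Fin 2) ℝ) * (M : Matrix (Fin 2) (Fin 2) ℝ) = 1 :=
    congrArg (fun N : SL2 => (N : Matrix (Fin 2) (Fin 2) ℝ)) (inv_mul_cancel M)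
  rw [cocIterZ_neg_natCast, ← hy, ← hM, mulVec_mulVec, hinv, one_mulVec] at hup
  rw [← hM] at hlow
  set U := (d y).rep
  set W := (d' y).rep
  have hUpos : 0 < ‖U‖ := norm_pos_iff.2 (d y).rep_nonzero
  have hWpos : 0 < ‖W‖ := norm_pos_iff.2 (d' y).rep_nonzero
  have hlow' : δ * ‖U‖ ≤ 2 * ‖(M : Matrix (Fin 2) (Fin 2) ℝ) *ᵥ U‖ := by
    refine le_of_sq_le_sq ?_ (by positivity)
    rw [mul_pow, mul_pow]
    linarith [sq_nonneg ‖(M : Matrix (Fin 2) (Fin 2) ℝ) *ᵥ U‖]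
  have hlk : 0 < l ^ k := by positivity
  have hup' : l ^ k * ‖W‖ ≤ C * ‖(M : Matrix (Fin 2) (Fin 2) ℝ) *ᵥ W‖ := by
    calc l ^ k * ‖W‖ ≤ l ^ k * (C * (l ^ k)⁻¹ * ‖(M : Matrix (Fin 2) (Fin 2) ℝ) *ᵥ W‖) := by
          gcongr
      _ = _ := by field_simp
  have hfin : (δ * l ^ k) * (‖U‖ * ‖W‖) ≤ (4 * C) * (‖U‖ * ‖W‖) := by
    calc (δ * l ^ k) * (‖U‖ * ‖W‖) = (δ * ‖U‖) * (l ^ k * ‖W‖) := by ring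
      _ ≤ (2 * ‖(M : Matrix (Fin 2) (Fin 2) ℝ) *ᵥ U‖) *
          (C * ‖(M : Matrix (Fin 2) (Fin 2) ℝ) *ᵥ W‖) := by gcongr
      _ = 2 * C * (‖(M : Matrix (Fin 2) (Fin 2) ℝ) *ᵥ U‖ *
          ‖(M : Matrix (Fin 2) (Fin 2) ℝ) *ᵥ W‖) := by ring
      _ ≤ 2 * C * (2 * ‖U‖ * ‖W‖) := by gcongr
      _ = _ := by ring
  have := le_of_mul_le_mul_right hfin (by positivity)
  rw [div_lt_iff₀ hδ] at hk
  linarith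

end Homotopy

/-- If `E ∉ Σ₁`, then `(E - S) ∩ Σ₀ = ∅`, and for all `v, v' ∈ S`, any
unstable sections of the Schrödinger cocycles `(T, A_{E-v})` and `(T, A_{E-v'})` are
homotopic as maps `X → ℝP¹`. -/
theorem not_mem_perturbed_spectrum_inter_empty_and_homotopic
    {X : Type*} [MetricSpace X] [CompactSpace X] [Nonempty X]
    [MeasurableSpace X] [BorelSpace X]
    -- `T` is a homeomorphism of `X`
    (T : X ≃ₜ X)
    -- `μ` is an ergodic Borel probability measure with full topological support
    (μ : Measure X) [IsProbabilityMeasure μ]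
    (hT : Ergodic T μ)
    (hfull : ∀ U : Set X, IsOpen U → U.Nonempty → μ U ≠ 0)
    -- the continuous sampling function
    (f : C(X, ℝ))
    -- the unperturbed Schrödinger operators `H_x` on `ℓ²(ℤ)`
    (H : X → (lp (fun _ : ℤ => ℝ) 2 →L[ℝ] lp (fun _ : ℤ => ℝ) 2))
    (hH : ∀ (x : X) (ψ : lp (fun _ : ℤ => ℝ) 2) (n : ℤ),
      (H x ψ) n = ψ (n + 1) + ψ (n - 1) + f ((T.toEquiv ^ n) x) * ψ n)
    (hHsa : ∀ x, IsSelfAdjoint (H x))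
    -- the unperturbed almost sure spectrum `Λ₀`
    (Λ₀ : Set ℝ) (hΛ₀compact : IsCompact Λ₀)
    (hΛ₀ : ∀ᵐ x ∂μ, spectrum ℝ (H x) = Λ₀)
    -- the single-site measure `ν` with compact support `S` containing at least two points
    (ν : Measure ℝ) [IsProbabilityMeasure ν]
    (S : Set ℝ) (hS : S = {v : ℝ | ∀ U ∈ 𝓝 v, ν U ≠ 0})
    (hScompact : IsCompact S) (hStwo : S.Nontrivial)
    -- `ν'` is the product measure `ν^ℤ` on `ℝ^ℤ`
    (ν' : Measure (ℤ → ℝ)) [IsProbabilityMeasure ν']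
    (hν' : ∀ (F : Finset ℤ) (t : ℤ → Set ℝ), (∀ i, MeasurableSet (t i)) →
      ν' {ω | ∀ i ∈ F, ω i ∈ t i} = ∏ i ∈ F, ν (t i))
    -- the perturbed Schrödinger operators `H_{x,ω}` on `ℓ²(ℤ)`
    (H' : X → (ℤ → ℝ) → (lp (fun _ : ℤ => ℝ) 2 →L[ℝ] lp (fun _ : ℤ => ℝ) 2))
    (hH' : ∀ (x : X) (ω : ℤ → ℝ), (∀ n, ω n ∈ S) →
      ∀ (ψ : lp (fun _ : ℤ => ℝ) 2) (n : ℤ),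
        (H' x ω ψ) n = ψ (n + 1) + ψ (n - 1) + (f ((T.toEquiv ^ n) x) + ω n) * ψ n)
    (hH'sa : ∀ x ω, (∀ n, ω n ∈ S) → IsSelfAdjoint (H' x ω))
    -- the perturbed almost sure spectrum `Λ₁`
    (Λ₁ : Set ℝ) (hΛ₁compact : IsCompact Λ₁)
    (hΛ₁ : ∀ᵐ p ∂(μ.prod ν'), spectrum ℝ (H' p.1 p.2) = Λ₁)
    (E : ℝ) (hE : E ∉ Λ₁) :
    ((fun s => E - s) '' S) ∩ Λ₀ = ∅ ∧
      ∀ v ∈ S, ∀ v' ∈ S, ∀ d d' : C(X, RP1),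
        IsUnstableSection T (schrodingerCocycle (⇑f) (E - v)) d →
        IsUnstableSection T (schrodingerCocycle (⇑f) (E - v')) d' →
        d.Homotopic d' := by
  obtain rfl : S = ν.support := by
    rw [hS]
    ext v
    simp [Measure.mem_support_iff_forall, pos_iff_ne_zero]
  obtain ⟨δ, hδ, hball⟩ := Metric.isOpen_iff.1 hΛ₁compact.isClosed.isOpen_compl E hE
  have hgap : ∀ x (ω : ℤ → ℝ), (∀ n, ω n ∈ ν.support) → ∀ ψ,
      δ * ‖ψ‖ ≤ ‖H' x ω ψ - E • ψ‖ := by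
    refine fun x ω hω ψ => mul_norm_le_of_ae T hfull f hν' H' hH' hδ.le ?_ x hω ψ
    filter_upwards [hΛ₁, Measure.quasiMeasurePreserving_snd.ae (ae_forall_mem_support hν')]
      with p hp hpS
    refine ⟨hpS, (hH'sa p.1 p.2 hpS).mul_norm_le_norm_sub_smul hδ.le fun b hb => ?_⟩
    by_contra! hlt
    exact hball (by rwa [Metric.mem_ball, Real.dist_eq]) (hp ▸ hb)
  constructor
  · rw [Set.eq_empty_iff_forall_notMem]
    rintro _ ⟨⟨s, hs, rfl⟩, hmem⟩
    obtain ⟨x, hx⟩ := hΛ₀.exists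
    rw [← hx] at hmem
    refine (hHsa x).notMem_spectrum_of_mul_norm_le hδ (fun ψ => ?_) hmem
    have he : H x ψ - (E - s) • ψ = H' x (fun _ => s) ψ - E • ψ := by
      ext n
      rw [lp.sub_smul_apply, lp.sub_smul_apply, hH, hH' x _ fun _ => hs]
      ring
    have h := hgap x (fun _ => s) (fun _ => hs) ψ
    rw [← he] at h
    exact h
  · intro v hv v' hv' d d' hd hd'
    have hω : ∀ n : ℤ, (if n < 0 then v else v') ∈ ν.support := fun n => by
      split_ifs <;> assumption
    exact homotopic_of_isUnstableSection T f hδ hd hd'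
      (fun y => H' y fun n => if n < 0 then v else v')
      (fun y => hH' y _ hω) fun y => hgap y _ hω

end
end

section
/- Assume additionally that X is connected. Let E₁ < E₂ be real numbers such that the cocycles (T, A_{E₁}) and (T, A_{E₂}) are uniformly hyperbolic. Then either [E₁, E₂] ∩ Σ₀ = ∅, or Σ₀ ⊆ (E₁, E₂), or for every unstable section d₁ of (T, A_{E₁}) and every unstable section d₂ of (T, A_{E₂}), the maps d₁ and d₂ are not homotopic. -/
open MeasureTheory Topology
open scoped Pointwise ENNReal

noncomputable section

/-- Operator norm of a matrix in `SL(2,ℝ)` (acting on Euclidean `ℝ²`). -/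
def SL2norm (A : SL2) : ℝ := ‖Matrix.toEuclideanCLM (𝕜 := ℝ) (A : Matrix (Fin 2) (Fin 2) ℝ)‖

/-- Uniform hyperbolicity of the cocycle `(T, A)`. -/
def UniformlyHyperbolic {X : Type*} [TopologicalSpace X] (T : X ≃ₜ X) (A : X → SL2) : Prop :=
  ∃ C > 0, ∃ l > 1, ∀ (x : X) (n : ℤ), C * l ^ |n| ≤ SL2norm (cocIterZ T A n x)

/-- A real number at distance `c > 0` from the approximate point spectrum of a self-adjoint operator
lies in its resolvent set. -/
theorem notMem_spectrum_of_norm_sub_smul_ge {V : Type*} [NormedAddCommGroup V]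
    [InnerProductSpace ℝ V] [CompleteSpace V] {S : V →L[ℝ] V} (hS : IsSelfAdjoint S) {r c : ℝ}
    (hc : 0 < c) (h : ∀ ψ, c * ‖ψ‖ ≤ ‖S ψ - r • ψ‖) : r ∉ spectrum ℝ S := by
  rw [spectrum.notMem_iff, ContinuousLinearMap.isUnit_iff_bijective]
  set B : V →L[ℝ] V := algebraMap ℝ (V →L[ℝ] V) r - S with hB
  have hBapp : ∀ ψ, B ψ = r • ψ - S ψ := fun ψ => by
    simp [hB, Algebra.algebraMap_eq_smul_one]
  have hbound : ∀ ψ, ‖ψ‖ ≤ (⟨c⁻¹, by positivity⟩ : NNReal) * ‖B ψ‖ := fun ψ => by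
    have := h ψ
    rw [hBapp, norm_sub_rev]
    change ‖ψ‖ ≤ c⁻¹ * _
    rw [inv_mul_eq_div, le_div_iff₀ hc]
    linarith
  have hanti := B.antilipschitz_of_bound hbound
  have hBsa : IsSelfAdjoint B := (IsSelfAdjoint.algebraMap _ (IsSelfAdjoint.all r)).sub hS
  refine (ContinuousLinearMap.bijective_iff_dense_range_and_antilipschitz B).2 ⟨?_, _, hanti⟩
  rw [Submodule.topologicalClosure_eq_top_iff, ContinuousLinearMap.orthogonal_range,
    hBsa.adjoint_eq]
  exact LinearMap.ker_eq_bot.2 hanti.injective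

/-- Finitely supported sequences are dense in `ℓ²(ℤ)`: a closed property that holds for all of them
holds everywhere. -/
theorem lp_int_closed_induction {P : lp (fun _ : ℤ => ℝ) 2 → Prop} (hP : IsClosed {ψ | P ψ})
    (h : ∀ ψ : lp (fun _ : ℤ => ℝ) 2, (∃ s : Finset ℤ, ∀ n ∉ s, ψ n = 0) → P ψ) (ψ) : P ψ := by
  refine hP.mem_of_tendsto (lp.hasSum_single (by simp) ψ)
    (Filter.Eventually.of_forall fun s => h _ ⟨s, fun n hn => ?_⟩)
  rw [lp.coeFn_sum, Finset.sum_apply]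
  refine Finset.sum_eq_zero fun i hi => ?_
  rw [lp.single_apply, Pi.single_eq_of_ne]
  rintro rfl
  exact hn hi

/-- The double commutation identity: if `u₁`, `u₂` solve the eigenvalue equations at `E₁`, `E₂` and
the products of consecutive values of their Wronskian have a fixed sign, then
`(S - E₁) (S - E₂)` has that sign as a quadratic form. -/
theorem inner_sub_smul_nonneg_of_wronskian {S : lp (fun _ : ℤ => ℝ) 2 →L[ℝ] lp (fun _ : ℤ => ℝ) 2}
    {w : ℤ → ℝ} (hS : ∀ ψ n, (S ψ) n = ψ (n + 1) + ψ (n - 1) + w n * ψ n)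
    {u₁ u₂ : ℤ → ℝ} {E₁ E₂ ε : ℝ}
    (hu₁ : ∀ n, u₁ (n + 1) = (E₁ - w n) * u₁ n - u₁ (n - 1))
    (hu₂ : ∀ n, u₂ (n + 1) = (E₂ - w n) * u₂ n - u₂ (n - 1))
    (hε : ∀ n, 0 < ε * ((u₁ n * u₂ (n - 1) - u₁ (n - 1) * u₂ n) *
      (u₁ (n + 1) * u₂ n - u₁ n * u₂ (n + 1)))) (ψ : lp (fun _ : ℤ => ℝ) 2) :
    0 ≤ ε * inner ℝ (S ψ - E₁ • ψ) (S ψ - E₂ • ψ) := by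
  have hclosed : IsClosed {ψ : lp (fun _ : ℤ => ℝ) 2 |
      0 ≤ ε * inner ℝ (S ψ - E₁ • ψ) (S ψ - E₂ • ψ)} :=
    isClosed_le continuous_const (by fun_prop)
  refine lp_int_closed_induction hclosed (fun ψ hψ => ?_) ψ
  obtain ⟨s, hs⟩ := hψ
  set W : ℤ → ℝ := fun n => u₁ n * u₂ (n - 1) - u₁ (n - 1) * u₂ n with hW
  set p₁ : ℤ → ℝ := fun n => ψ n * u₁ (n - 1) - ψ (n - 1) * u₁ n with hp₁
  set p₂ : ℤ → ℝ := fun n => ψ n * u₂ (n - 1) - ψ (n - 1) * u₂ n with hp₂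
  set Q : ℤ → ℝ := fun n => (E₁ - E₂) * (p₁ n * p₂ n) / W n with hQ
  have hWne : ∀ n, W n ≠ 0 := fun n h0 => by
    have := hε n
    simp only [hW] at h0
    simp [h0] at this
  have hQsum : Summable Q := by
    refine summable_of_ne_finset_zero (s := s ∪ s.image (· + 1)) fun n hn => ?_
    rw [Finset.mem_union, not_or] at hn
    have h1 : ψ n = 0 := hs n hn.1
    have h2 : ψ (n - 1) = 0 := hs _ fun h => hn.2 (Finset.mem_image.2 ⟨_, h, by ring⟩)
    simp [hQ, hp₁, h1, h2]
  have hQtel : HasSum (fun n => Q (n + 1) - Q n) 0 := by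
    have h := hQsum.hasSum
    have h' := (Equiv.addRight (1 : ℤ)).hasSum_iff.2 h
    simpa using h'.sub h
  have hinner := lp.hasSum_inner (𝕜 := ℝ) (G := fun _ : ℤ => ℝ) (S ψ - E₁ • ψ) (S ψ - E₂ • ψ)
  have hdiff := (hinner.sub hQtel).mul_left ε
  rw [sub_zero] at hdiff
  refine hdiff.nonneg fun n => ?_
  have hWn := hWne n
  have hWn1 := hWne (n + 1)
  have hεn := hε n
  set g₁ : ℝ := ψ (n + 1) + ψ (n - 1) + w n * ψ n - E₁ * ψ n with hg₁
  set g₂ : ℝ := ψ (n + 1) + ψ (n - 1) + w n * ψ n - E₂ * ψ n with hg₂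
  have hWW : W (n + 1) = W n + (E₁ - E₂) * (u₁ n * u₂ n) := by
    simp only [hW, add_sub_cancel_right, hu₁ n, hu₂ n]
    ring
  have hpp₁ : p₁ (n + 1) = p₁ n + g₁ * u₁ n := by
    simp only [hp₁, add_sub_cancel_right, hu₁ n, hg₁]
    ring
  have hpp₂ : p₂ (n + 1) = p₂ n + g₂ * u₂ n := by
    simp only [hp₂, add_sub_cancel_right, hu₂ n, hg₂]
    ring
  have hψW : g₂ = g₁ + (E₁ - E₂) * ψ n := by simp only [hg₁, hg₂]; ring
  have hψW' : ψ n * W n = p₂ n * u₁ n - p₁ n * u₂ n := by simp only [hW, hp₁, hp₂]; ring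
  have hkey : g₁ * g₂ - (Q (n + 1) - Q n) =
      (g₁ * W n - (E₁ - E₂) * (p₁ n * u₂ n)) ^ 2 / (W n * W (n + 1)) := by
    have h2 : g₂ * W n - (E₁ - E₂) * (p₂ n * u₁ n) = g₁ * W n - (E₁ - E₂) * (p₁ n * u₂ n) := by
      rw [hψW]
      linear_combination (E₁ - E₂) * hψW'
    rw [sq]
    nth_rewrite 2 [← h2]
    simp only [hQ]
    rw [hpp₁, hpp₂]
    field_simp
    rw [hWW]
    ring
  have hcoord : inner ℝ ((S ψ - E₁ • ψ) n) ((S ψ - E₂ • ψ) n) = g₁ * g₂ := by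
    simp only [lp.coeFn_sub, lp.coeFn_smul, Pi.sub_apply, Pi.smul_apply, hS, smul_eq_mul,
      RCLike.inner_apply, conj_trivial, hg₁, hg₂]
    ring
  rw [hcoord, hkey]
  have hpos : 0 < ε * (W n * W (n + 1)) := by simpa [hW] using hεn
  have hWW0 : W n * W (n + 1) ≠ 0 := mul_ne_zero hWn hWn1
  have : ε * ((g₁ * W n - (E₁ - E₂) * (p₁ n * u₂ n)) ^ 2 / (W n * W (n + 1))) =
      (ε * (W n * W (n + 1))) *
        ((g₁ * W n - (E₁ - E₂) * (p₁ n * u₂ n)) / (W n * W (n + 1))) ^ 2 := by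
    field_simp
  rw [this]
  positivity

theorem inner_sub_smul_sub_smul_eq {V : Type*} [NormedAddCommGroup V] [InnerProductSpace ℝ V]
    (x ψ : V) (a b : ℝ) :
    inner ℝ (x - a • ψ) (x - b • ψ) =
      ‖x - ((a + b) / 2) • ψ‖ ^ 2 - ((b - a) / 2 * ‖ψ‖) ^ 2 := by
  have h₁ : x - a • ψ = (x - ((a + b) / 2) • ψ) + ((b - a) / 2) • ψ := by module
  have h₂ : x - b • ψ = (x - ((a + b) / 2) • ψ) - ((b - a) / 2) • ψ := by module
  rw [h₁, h₂, inner_sub_right, inner_add_left, inner_add_left,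
    real_inner_comm (x - ((a + b) / 2) • ψ) (((b - a) / 2) • ψ),
    real_inner_self_eq_norm_sq, real_inner_self_eq_norm_sq, norm_smul, mul_pow, mul_pow,
    Real.norm_eq_abs, sq_abs]
  ring

/-- If `(S - E₁) (S - E₂) ≥ 0` then `S` has no spectrum in the open interval `(E₁, E₂)`. -/
theorem notMem_spectrum_of_mem_Ioo {V : Type*} [NormedAddCommGroup V] [InnerProductSpace ℝ V]
    [CompleteSpace V] {S : V →L[ℝ] V} (hS : IsSelfAdjoint S) {E₁ E₂ E : ℝ}
    (h : ∀ ψ, 0 ≤ inner ℝ (S ψ - E₁ • ψ) (S ψ - E₂ • ψ)) (hE : E ∈ Set.Ioo E₁ E₂) :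
    E ∉ spectrum ℝ S := by
  obtain ⟨hE₁, hE₂⟩ := hE
  refine notMem_spectrum_of_norm_sub_smul_ge hS (c := (E₂ - E₁) / 2 - |(E₁ + E₂) / 2 - E|) ?_
    fun ψ => ?_
  · rw [sub_pos, abs_lt]
    constructor <;> linarith
  · have h₁ := h ψ
    rw [inner_sub_smul_sub_smul_eq, sub_nonneg] at h₁
    have h₂ := (abs_le_of_sq_le_sq' h₁ (norm_nonneg _)).2
    have h₃ : S ψ - ((E₁ + E₂) / 2) • ψ = (S ψ - E • ψ) - ((E₁ + E₂) / 2 - E) • ψ := by module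
    have h₄ := norm_sub_le (S ψ - E • ψ) (((E₁ + E₂) / 2 - E) • ψ)
    rw [← h₃, norm_smul, Real.norm_eq_abs] at h₄
    linarith

/-- If `(S - E₁) (S - E₂) ≤ 0` then the spectrum of `S` is contained in `[E₁, E₂]`. -/
theorem spectrum_subset_Icc {V : Type*} [NormedAddCommGroup V] [InnerProductSpace ℝ V]
    [CompleteSpace V] {S : V →L[ℝ] V} (hS : IsSelfAdjoint S) {E₁ E₂ : ℝ} (hE : E₁ < E₂)
    (h : ∀ ψ, inner ℝ (S ψ - E₁ • ψ) (S ψ - E₂ • ψ) ≤ 0) :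
    spectrum ℝ S ⊆ Set.Icc E₁ E₂ := by
  intro E hEs
  by_contra hE'
  refine notMem_spectrum_of_norm_sub_smul_ge hS (c := |(E₁ + E₂) / 2 - E| - (E₂ - E₁) / 2) ?_
    (fun ψ => ?_) hEs
  · rw [sub_pos, lt_abs]
    rw [Set.mem_Icc, not_and_or, not_le, not_le] at hE'
    rcases hE' with hE' | hE'
    · left; linarith
    · right; linarith
  · have h₁ := h ψ
    rw [inner_sub_smul_sub_smul_eq, sub_nonpos] at h₁
    have h₂ := (abs_le_of_sq_le_sq' h₁ (by have := norm_nonneg ψ; nlinarith)).2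
    have h₃ : ((E₁ + E₂) / 2 - E) • ψ = (S ψ - E • ψ) - (S ψ - ((E₁ + E₂) / 2) • ψ) := by module
    have h₄ := norm_sub_le (S ψ - E • ψ) (S ψ - ((E₁ + E₂) / 2) • ψ)
    rw [← h₃, norm_smul, Real.norm_eq_abs] at h₄
    linarith

/-- An `ℓ²` bound for solutions of a contracting recursive inequality over `ℤ`. -/
theorem tsum_sq_le_of_contracting {P G : ℤ → ℝ} (e : ℤ ≃ ℤ) {a : ℝ} (ha0 : 0 ≤ a) (ha1 : a < 1)
    (hP0 : ∀ n, 0 ≤ P n) (hP : Summable fun n => P n ^ 2) (hG : Summable fun n => G n ^ 2)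
    (h : ∀ n, P (e n) ≤ a * P n + G n) :
    ∑' n, P n ^ 2 ≤ ((1 - a) ^ 2)⁻¹ * ∑' n, G n ^ 2 := by
  have ha : 0 < 1 - a := by linarith
  have hpt : ∀ n, P (e n) ^ 2 ≤ a * P n ^ 2 + (1 - a)⁻¹ * G n ^ 2 := fun n => by
    have h1 : P (e n) ^ 2 ≤ (a * P n + G n) ^ 2 := pow_le_pow_left₀ (hP0 _) (h n) 2
    have h2 : a * P n ^ 2 + (1 - a)⁻¹ * G n ^ 2 - (a * P n + G n) ^ 2 =
        a * (1 - a)⁻¹ * ((1 - a) * P n - G n) ^ 2 := by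
      field_simp
      ring
    have h3 : 0 ≤ a * (1 - a)⁻¹ * ((1 - a) * P n - G n) ^ 2 := by positivity
    linarith
  have hsum : ∑' n, P (e n) ^ 2 ≤ ∑' n, (a * P n ^ 2 + (1 - a)⁻¹ * G n ^ 2) :=
    Summable.tsum_le_tsum hpt (e.summable_iff.2 hP) ((hP.mul_left _).add (hG.mul_left _))
  rw [e.tsum_eq (fun n => P n ^ 2), (hP.mul_left _).tsum_add (hG.mul_left _), tsum_mul_left,
    tsum_mul_left] at hsum
  have : (1 - a) * ∑' n, P n ^ 2 ≤ (1 - a)⁻¹ * ∑' n, G n ^ 2 := by linarith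
  rw [sq, mul_inv, mul_assoc, inv_mul_eq_div _ (_ * _), le_div_iff₀ ha]
  linarith

/-- A weight bounded up to constants by `M` and growing at least by the factor `l` at each step. -/
theorem exists_adapted_weight {M : ℤ → ℝ} {C l : ℝ} (hl : 1 < l)
    (hdecay : ∀ (n : ℤ) (k : ℕ), l ^ k * M (n - k) ≤ C * M n) :
    ∃ N : ℤ → ℝ, (∀ n, M n ≤ N n) ∧ (∀ n, N n ≤ C * M n) ∧ ∀ n, N n ≤ l⁻¹ * N (n + 1) := by
  have hl0 : 0 < l := by linarith
  have hbdd : ∀ n, BddAbove (Set.range fun k : ℕ => l ^ k * M (n - k)) := fun n =>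
    ⟨C * M n, by rintro _ ⟨k, rfl⟩; exact hdecay n k⟩
  refine ⟨fun n => ⨆ k : ℕ, l ^ k * M (n - k), fun n => by simpa using le_ciSup (hbdd n) 0,
    fun n => ciSup_le (hdecay n), fun n => ciSup_le fun k => ?_⟩
  have := le_ciSup (hbdd (n + 1)) (k + 1)
  rw [inv_mul_eq_div, le_div_iff₀ hl0]
  refine le_trans (le_of_eq ?_) this
  push_cast
  rw [pow_succ, show n + 1 - ((k : ℤ) + 1) = n - k by ring]
  ring

/-- One step of the inhomogeneous eigenvalue equation for the component of `(x, y)` along the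
solution `(a, b)`. -/
theorem projection_step {a b e x y g : ℝ} (hD : a ^ 2 + b ^ 2 ≠ 0)
    (hD' : (e * a - b) ^ 2 + a ^ 2 ≠ 0) :
    ((e * x - y + g) * (e * a - b) + x * a) / ((e * a - b) ^ 2 + a ^ 2) =
      (x * a + y * b) / (a ^ 2 + b ^ 2) +
      (x * b - y * a) * ((e * b + a) * (e * a - b) + a * b) /
        ((a ^ 2 + b ^ 2) * ((e * a - b) ^ 2 + a ^ 2)) +
      g * (e * a - b) / ((e * a - b) ^ 2 + a ^ 2) := by
  field_simp
  ring

/-- Pointwise bound for the backward recursion of the component along the growing solution. -/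
theorem abs_projection_step_le {a b a' e r r' p g m m' N N' C l F : ℝ} 
    (hm : 0 < m) (hm' : 0 < m') (ha : |a| ≤ m) (hb : |b| ≤ m) (ha' : |a'| ≤ m') (hab : |a| ≤ m')
    (hD : m ^ 2 ≤ a ^ 2 + b ^ 2) (hD' : m' ^ 2 ≤ a' ^ 2 + a ^ 2) (hmN : m ≤ N)
    (hNm : N ≤ C * m) (hNm' : N' ≤ C * m') (hNN : N ≤ l⁻¹ * N') (hNle : N ≤ N') (he : |e| ≤ F)
    (hr : r' = r + p * ((e * b + a) * a' + a * b) / ((a ^ 2 + b ^ 2) * (a' ^ 2 + a ^ 2)) +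
      g * a' / (a' ^ 2 + a ^ 2)) :
    |r| * N ≤ l⁻¹ * (|r'| * N') + (C ^ 2 * (F + 2) * (|p| / N) + C * |g|) := by
  have hN : 0 < N := hm.trans_le hmN
  have hF : 0 ≤ F := (abs_nonneg _).trans he
  have hC : 0 < C := pos_of_mul_pos_left (hN.trans_le hNm) hm.le
  have hDpos : 0 < a ^ 2 + b ^ 2 := (pow_pos hm 2).trans_le hD
  have hDpos' : 0 < a' ^ 2 + a ^ 2 := (pow_pos hm' 2).trans_le hD'
  have hnum : |(e * b + a) * a' + a * b| ≤ (F + 2) * (m * m') := by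
    have h1 : |(e * b + a) * a'| ≤ ((F + 1) * m) * m' := by
      rw [abs_mul]
      refine mul_le_mul ?_ ha' (abs_nonneg _) (by positivity)
      calc |e * b + a| ≤ |e| * |b| + |a| := by rw [← abs_mul]; exact abs_add_le _ _
        _ ≤ F * m + m := by gcongr
        _ = (F + 1) * m := by ring
    have h2 : |a * b| ≤ m' * m := by rw [abs_mul]; gcongr
    calc _ ≤ |(e * b + a) * a'| + |a * b| := abs_add_le _ _
      _ ≤ ((F + 1) * m) * m' + m' * m := add_le_add h1 h2
      _ = _ := by ring
  have hp : |p * ((e * b + a) * a' + a * b) / ((a ^ 2 + b ^ 2) * (a' ^ 2 + a ^ 2))| ≤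
      (F + 2) * |p| / (m * m') := by
    rw [abs_div, abs_mul, abs_of_pos (mul_pos hDpos hDpos')]
    calc |p| * |(e * b + a) * a' + a * b| / ((a ^ 2 + b ^ 2) * (a' ^ 2 + a ^ 2))
        ≤ |p| * ((F + 2) * (m * m')) / (m ^ 2 * m' ^ 2) := by gcongr
      _ = _ := by field_simp
  have hg : |g * a' / (a' ^ 2 + a ^ 2)| ≤ |g| / m' := by
    rw [abs_div, abs_mul, abs_of_pos hDpos']
    calc |g| * |a'| / (a' ^ 2 + a ^ 2) ≤ |g| * m' / m' ^ 2 := by gcongr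
      _ = _ := by field_simp
  have hr' : |r| ≤ |r'| + (F + 2) * |p| / (m * m') + |g| / m' := by
    have : r = r' - p * ((e * b + a) * a' + a * b) / ((a ^ 2 + b ^ 2) * (a' ^ 2 + a ^ 2)) -
      g * a' / (a' ^ 2 + a ^ 2) := by rw [hr]; ring
    rw [this]
    refine (abs_sub _ _).trans (add_le_add ((abs_sub _ _).trans ?_) hg)
    gcongr
  have hNC : N / m' ≤ C := by rw [div_le_iff₀ hm']; linarith
  have hmC : m⁻¹ ≤ C * N⁻¹ := by
    rw [← div_eq_mul_inv, inv_eq_one_div, div_le_div_iff₀ hm hN]; linarith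
  calc |r| * N ≤ (|r'| + (F + 2) * |p| / (m * m') + |g| / m') * N := by gcongr
    _ = |r'| * N + (F + 2) * |p| * m⁻¹ * (N / m') + |g| * (N / m') := by field_simp
    _ ≤ |r'| * (l⁻¹ * N') + (F + 2) * |p| * (C * N⁻¹) * C + |g| * C := by gcongr
    _ = _ := by ring

set_option maxHeartbeats 1000000 in
/-- If the eigenvalue equation at `E` has a solution decaying uniformly exponentially in backward
direction, then square-summable solutions of the inhomogeneous equation are controlled by the
inhomogeneity. -/
theorem tsum_sq_le_of_decay {e u M : ℤ → ℝ} {C l F : ℝ} (hl : 1 < l)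
    (hu : ∀ n, u (n + 1) = e n * u n - u (n - 1))
    (hM0 : ∀ n, 0 < M n) (hMu : ∀ n, |u n| ≤ M n) (hMu' : ∀ n, |u (n - 1)| ≤ M n)
    (hMS : ∀ n, M n ^ 2 ≤ u n ^ 2 + u (n - 1) ^ 2)
    (hdecay : ∀ (n : ℤ) (k : ℕ), l ^ k * M (n - k) ≤ C * M n)
    (hF : ∀ n, |e n| ≤ F) :
    ∃ K ≥ 0, ∀ ψ g : ℤ → ℝ, (Summable fun n => ψ n ^ 2) → (Summable fun n => g n ^ 2) →
      (∀ n, ψ (n + 1) = e n * ψ n - ψ (n - 1) + g n) →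
      ∑' n, ψ n ^ 2 ≤ K * ∑' n, g n ^ 2 := by
  obtain ⟨N, hMN, hNM, hgrow⟩ := exists_adapted_weight hl hdecay
  have hC0 : 0 ≤ C := (pos_of_mul_pos_left ((hM0 0).trans_le ((hMN 0).trans (hNM 0)))
    (hM0 0).le).le
  have hNpos : ∀ n, 0 < N n := fun n => (hM0 n).trans_le (hMN n)
  obtain ⟨a, ha⟩ : ∃ a, a = l⁻¹ := ⟨_, rfl⟩
  have ha0 : 0 ≤ a := by rw [ha]; positivity
  have ha1 : a < 1 := by rw [ha]; exact inv_lt_one_of_one_lt₀ hl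
  obtain ⟨A, hA⟩ : ∃ A, A = ((1 - a) ^ 2)⁻¹ := ⟨_, rfl⟩
  have hA0 : 0 ≤ A := by rw [hA]; positivity
  obtain ⟨B, hB⟩ : ∃ B, B = C ^ 2 * (F + 2) := ⟨_, rfl⟩
  refine ⟨2 * (A * (2 * B ^ 2 * A + 2 * C ^ 2)) + 2 * C ^ 2 * A, by positivity,
    fun ψ g hψ hg hψstep => ?_⟩
  have hDpos : ∀ n, 0 < u n ^ 2 + u (n - 1) ^ 2 := fun n => (pow_pos (hM0 n) 2).trans_le (hMS n)
  have hψ' : Summable fun n => ψ (n - 1) ^ 2 := (Equiv.subRight (1 : ℤ)).summable_iff.2 hψ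
  obtain ⟨p, hp⟩ : ∃ p : ℤ → ℝ, ∀ n, p n = ψ n * u (n - 1) - ψ (n - 1) * u n :=
    ⟨_, fun _ => rfl⟩
  obtain ⟨r, hr⟩ : ∃ r : ℤ → ℝ, ∀ n,
      r n = (ψ n * u n + ψ (n - 1) * u (n - 1)) / (u n ^ 2 + u (n - 1) ^ 2) := ⟨_, fun _ => rfl⟩
  obtain ⟨P, hP⟩ : ∃ P : ℤ → ℝ, ∀ n, P n = |p n| / N n := ⟨_, fun _ => rfl⟩
  obtain ⟨R, hR⟩ : ∃ R : ℤ → ℝ, ∀ n, R n = |r n| * N n := ⟨_, fun _ => rfl⟩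
  obtain ⟨G, hG⟩ : ∃ G : ℤ → ℝ, ∀ n, G n = B * P n + C * |g n| := ⟨_, fun _ => rfl⟩
  have hP0 : ∀ n, 0 ≤ P n := fun n => hP n ▸ div_nonneg (abs_nonneg _) (hNpos n).le
  have hR0 : ∀ n, 0 ≤ R n := fun n => hR n ▸ mul_nonneg (abs_nonneg _) (hNpos n).le
  have hsum2 : Summable fun n => (|ψ n| + |ψ (n - 1)|) ^ 2 := by
    refine Summable.of_nonneg_of_le (fun n => sq_nonneg _) (fun n => ?_)
      ((hψ.mul_left 2).add (hψ'.mul_left 2))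
    rw [← sq_abs (ψ n), ← sq_abs (ψ (n - 1))]
    nlinarith [sq_nonneg (|ψ n| - |ψ (n - 1)|)]
  have hPle : ∀ n, P n ≤ |ψ n| + |ψ (n - 1)| := fun n => by
    rw [hP, div_le_iff₀ (hNpos n), hp]
    calc _ ≤ |ψ n * u (n - 1)| + |ψ (n - 1) * u n| := abs_sub _ _
      _ ≤ |ψ n| * N n + |ψ (n - 1)| * N n := by
        rw [abs_mul, abs_mul]
        gcongr
        · exact (hMu' n).trans (hMN n)
        · exact (hMu n).trans (hMN n)
      _ = _ := by ring
  have hRle : ∀ n, R n ≤ C * (|ψ n| + |ψ (n - 1)|) := fun n => by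
    rw [hR, hr, abs_div, abs_of_pos (hDpos n), div_mul_eq_mul_div, div_le_iff₀ (hDpos n)]
    calc |ψ n * u n + ψ (n - 1) * u (n - 1)| * N n
        ≤ (|ψ n| * M n + |ψ (n - 1)| * M n) * (C * M n) := by
          refine mul_le_mul ((abs_add_le _ _).trans ?_) (hNM n) (hNpos n).le ?_
          · rw [abs_mul, abs_mul]
            gcongr
            · exact hMu n
            · exact hMu' n
          · have := hM0 n
            positivity
      _ = C * (|ψ n| + |ψ (n - 1)|) * M n ^ 2 := by ring
      _ ≤ _ := by gcongr; exact hMS n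
  have hPsum : Summable fun n => P n ^ 2 :=
    Summable.of_nonneg_of_le (fun n => sq_nonneg _)
      (fun n => pow_le_pow_left₀ (hP0 n) (hPle n) 2) hsum2
  have hRsum : Summable fun n => R n ^ 2 := by
    refine Summable.of_nonneg_of_le (fun n => sq_nonneg _)
      (fun n => pow_le_pow_left₀ (hR0 n) (hRle n) 2) ?_
    simp only [mul_pow]
    exact hsum2.mul_left _
  have hgabs : Summable fun n => |g n| ^ 2 := by simpa only [sq_abs] using hg
  have hPrec : ∀ n, P (Equiv.addRight (1 : ℤ) n) ≤ a * P n + |g n| := fun n => by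
    have hstep : p (n + 1) = p n + g n * u n := by
      rw [hp, hp, add_sub_cancel_right, hu n, hψstep n]
      ring
    have hun : |u n| ≤ N (n + 1) := by
      have := hMu' (n + 1)
      rw [add_sub_cancel_right] at this
      exact this.trans (hMN _)
    have h1 := hNpos (n + 1)
    have h0 := hNpos n
    rw [Equiv.coe_addRight, hP, hP, div_le_iff₀ h1, hstep]
    calc |p n + g n * u n| ≤ |p n| / N n * N n + |g n| * |u n| := by
          rw [div_mul_cancel₀ _ h0.ne', ← abs_mul]
          exact abs_add_le _ _
      _ ≤ |p n| / N n * (a * N (n + 1)) + |g n| * N (n + 1) := by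
          rw [ha]
          gcongr
          exact hgrow n
      _ = _ := by ring
  have hRrec : ∀ n, R n ≤ a * R (n + 1) + G n := fun n => by
    have h1 := hMu (n + 1)
    have h2 := hMu' (n + 1)
    have h3 := hMS (n + 1)
    have hD := (hDpos n).ne'
    have hD' := (hDpos (n + 1)).ne'
    rw [add_sub_cancel_right] at h2 h3 hD'
    have hle : N n ≤ N (n + 1) := (hgrow n).trans
      (mul_le_of_le_one_left (hNpos _).le (ha ▸ ha1.le))
    rw [hR, hR, hG, hP, hB, ha]
    refine abs_projection_step_le (hM0 n) (hM0 (n + 1)) (hMu n) (hMu' n) h1 h2 (hMS n) h3 (hMN n)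
      (hNM n) (hNM (n + 1)) (hgrow n) hle (hF n) ?_
    rw [hr, hr, hp, add_sub_cancel_right, hψstep n]
    rw [hu n] at hD' ⊢
    exact projection_step hD hD'
  have hPbound := tsum_sq_le_of_contracting (Equiv.addRight (1 : ℤ)) ha0 ha1 hP0 hPsum hgabs hPrec
  have hGpt : ∀ n, G n ^ 2 ≤ 2 * B ^ 2 * P n ^ 2 + 2 * C ^ 2 * |g n| ^ 2 := fun n => by
    rw [hG]
    nlinarith [sq_nonneg (B * P n - C * |g n|)]
  have hGsum : Summable fun n => G n ^ 2 :=
    Summable.of_nonneg_of_le (fun n => sq_nonneg _) hGpt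
      ((hPsum.mul_left _).add (hgabs.mul_left _))
  have hRbound := tsum_sq_le_of_contracting (G := fun n => G (n - 1)) (Equiv.subRight (1 : ℤ))
    ha0 ha1 hR0 hRsum ((Equiv.subRight (1 : ℤ)).summable_iff.2 hGsum) fun n => by
      simpa using hRrec (n - 1)
  have hGshift : ∑' n, G (n - 1) ^ 2 = ∑' n, G n ^ 2 :=
    (Equiv.subRight (1 : ℤ)).tsum_eq (fun n => G n ^ 2)
  rw [hGshift] at hRbound
  have hGbound : ∑' n, G n ^ 2 ≤ 2 * B ^ 2 * ∑' n, P n ^ 2 + 2 * C ^ 2 * ∑' n, |g n| ^ 2 := by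
    rw [← tsum_mul_left, ← tsum_mul_left, ← (hPsum.mul_left _).tsum_add (hgabs.mul_left _)]
    exact hGsum.tsum_le_tsum hGpt ((hPsum.mul_left _).add (hgabs.mul_left _))
  have hψpt : ∀ n, ψ n ^ 2 ≤ 2 * R n ^ 2 + 2 * C ^ 2 * P n ^ 2 := fun n => by
    have hD := hDpos n
    have hM := hM0 n
    have hN := hNpos n
    have hψeq : ψ n = r n * u n + p n * u (n - 1) / (u n ^ 2 + u (n - 1) ^ 2) := by
      rw [hr, hp]
      field_simp
      ring
    have h1 : |r n * u n| ≤ R n := by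
      rw [abs_mul, hR]
      gcongr
      exact (hMu n).trans (hMN n)
    have h2 : |p n * u (n - 1) / (u n ^ 2 + u (n - 1) ^ 2)| ≤ C * P n := by
      have hmC : (M n)⁻¹ ≤ C * (N n)⁻¹ := by
        rw [← div_eq_mul_inv, inv_eq_one_div, div_le_div_iff₀ hM hN]
        linarith [hNM n]
      rw [abs_div, abs_mul, abs_of_pos hD, hP]
      calc |p n| * |u (n - 1)| / (u n ^ 2 + u (n - 1) ^ 2) ≤ |p n| * M n / M n ^ 2 := by
            gcongr
            · exact hMu' n
            · exact hMS n
        _ = |p n| * (M n)⁻¹ := by field_simp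
        _ ≤ |p n| * (C * (N n)⁻¹) := by gcongr
        _ = C * (|p n| / N n) := by ring
    have h3 : |ψ n| ≤ R n + C * P n := by
      rw [hψeq]
      exact (abs_add_le _ _).trans (add_le_add h1 h2)
    rw [← sq_abs (ψ n)]
    refine (pow_le_pow_left₀ (abs_nonneg _) h3 2).trans ?_
    nlinarith [sq_nonneg (R n - C * P n)]
  have hψbound : ∑' n, ψ n ^ 2 ≤ 2 * ∑' n, R n ^ 2 + 2 * C ^ 2 * ∑' n, P n ^ 2 := by
    rw [← tsum_mul_left, ← tsum_mul_left, ← (hRsum.mul_left _).tsum_add (hPsum.mul_left _)]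
    exact hψ.tsum_le_tsum hψpt ((hRsum.mul_left _).add (hPsum.mul_left _))
  have hgeq : ∑' n, |g n| ^ 2 = ∑' n, g n ^ 2 := by simp only [sq_abs]
  rw [hgeq] at hGbound hPbound
  rw [← hA] at hPbound hRbound
  calc ∑' n, ψ n ^ 2 ≤ 2 * ∑' n, R n ^ 2 + 2 * C ^ 2 * ∑' n, P n ^ 2 := hψbound
    _ ≤ 2 * (A * (2 * B ^ 2 * (A * ∑' n, g n ^ 2) + 2 * C ^ 2 * ∑' n, g n ^ 2)) +
        2 * C ^ 2 * (A * ∑' n, g n ^ 2) := by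
      gcongr
      refine hRbound.trans ?_
      gcongr
      refine hGbound.trans ?_
      gcongr
    _ = _ := by ring

/-- If the eigenvalue equation at `E` has a solution decaying uniformly exponentially in backward
direction, then `S - E` is bounded below. -/
theorem exists_norm_sub_smul_ge_of_decay
    {S : lp (fun _ : ℤ => ℝ) 2 →L[ℝ] lp (fun _ : ℤ => ℝ) 2}
    {w : ℤ → ℝ} (hS : ∀ ψ n, (S ψ) n = ψ (n + 1) + ψ (n - 1) + w n * ψ n)
    {u M : ℤ → ℝ} {E C l F : ℝ} (hl : 1 < l)
    (hu : ∀ n, u (n + 1) = (E - w n) * u n - u (n - 1))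
    (hM0 : ∀ n, 0 < M n) (hMu : ∀ n, |u n| ≤ M n) (hMu' : ∀ n, |u (n - 1)| ≤ M n)
    (hMS : ∀ n, M n ^ 2 ≤ u n ^ 2 + u (n - 1) ^ 2)
    (hdecay : ∀ (n : ℤ) (k : ℕ), l ^ k * M (n - k) ≤ C * M n)
    (hF : ∀ n, |E - w n| ≤ F) :
    ∃ c > 0, ∀ ψ, c * ‖ψ‖ ≤ ‖S ψ - E • ψ‖ := by
  obtain ⟨K, hK0, hK⟩ := tsum_sq_le_of_decay (e := fun n => E - w n) hl hu hM0 hMu hMu' hMS hdecay hF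
  refine ⟨(Real.sqrt (K + 1))⁻¹, by positivity, fun ψ => ?_⟩
  have hnorm : ∀ φ : lp (fun _ : ℤ => ℝ) 2, HasSum (fun n => φ n ^ 2) (‖φ‖ ^ 2) := fun φ => by
    have := lp.hasSum_inner (𝕜 := ℝ) (G := fun _ : ℤ => ℝ) φ φ
    rw [real_inner_self_eq_norm_sq] at this
    simpa [sq] using this
  have h := hK ψ (S ψ - E • ψ : lp (fun _ : ℤ => ℝ) 2) (hnorm _).summable (hnorm _).summable
    fun n => by
      simp only [lp.coeFn_sub, lp.coeFn_smul, Pi.sub_apply, Pi.smul_apply, hS, smul_eq_mul]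
      ring
  rw [(hnorm _).tsum_eq, (hnorm _).tsum_eq] at h
  rw [inv_mul_eq_div, div_le_iff₀ (by positivity)]
  refine (abs_le_of_sq_le_sq' ?_ (by positivity)).2
  rw [mul_pow, Real.sq_sqrt (by positivity)]
  nlinarith [sq_nonneg ‖S ψ - E • ψ‖]

/-- The skew product `(x, v) ↦ (T x, A(x) v)`. -/
def skewProduct {X : Type*} [TopologicalSpace X] (T : X ≃ₜ X) (A : X → SL2) :
    Equiv.Perm (X × (Fin 2 → ℝ)) where
  toFun y := (T y.1, (A y.1).1.mulVec y.2)
  invFun y := (T.symm y.1, (A (T.symm y.1))⁻¹.1.mulVec y.2)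
  left_inv y := by
    ext1
    · simp
    · simp only [T.symm_apply_apply, Matrix.mulVec_mulVec]
      rw [← Matrix.SpecialLinearGroup.coe_mul, inv_mul_cancel]
      simp
  right_inv y := by
    ext1
    · simp
    · simp only [Matrix.mulVec_mulVec]
      rw [← Matrix.SpecialLinearGroup.coe_mul, mul_inv_cancel]
      simp

theorem SL2_mulVec_ne_zero (A : SL2) {v : Fin 2 → ℝ} (hv : v ≠ 0) : A.1.mulVec v ≠ 0 := by
  intro h
  have h' : (A⁻¹).1.mulVec (A.1.mulVec v) = 0 := by rw [h, Matrix.mulVec_zero]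
  rw [Matrix.mulVec_mulVec, ← Matrix.SpecialLinearGroup.coe_mul, inv_mul_cancel] at h'
  exact hv (by simpa using h')

theorem SL2act_mk (A : SL2) {v : Fin 2 → ℝ} (hv : v ≠ 0) :
    SL2act A (Projectivization.mk ℝ v hv) =
      Projectivization.mk ℝ (A.1.mulVec v) (SL2_mulVec_ne_zero A hv) := rfl

theorem SL2act_injective (A : SL2) : Function.Injective (SL2act A) :=
  Projectivization.map_injective _ (by
    rw [Matrix.coe_mulVecLin]
    exact Matrix.mulVec_injective_iff_isUnit.2 ((Matrix.isUnit_iff_isUnit_det _).2 (by simp)))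

/-- `v` is a nonzero vector on the line `p`. -/
def Spans (v : Fin 2 → ℝ) (p : RP1) : Prop := ∃ hv : v ≠ 0, Projectivization.mk ℝ v hv = p

theorem exists_spans (p : RP1) : ∃ v, Spans v p :=
  ⟨p.rep, p.rep_nonzero, p.mk_rep⟩

theorem IsInvariantSection.spans_iff {X : Type*} [TopologicalSpace X] {T : X ≃ₜ X} {A : X → SL2}
    {d : C(X, RP1)} (hd : IsInvariantSection T A d) (y : X × (Fin 2 → ℝ)) :
    Spans (skewProduct T A y).2 (d (skewProduct T A y).1) ↔ Spans y.2 (d y.1) := by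
  change Spans ((A y.1).1.mulVec y.2) (d (T y.1)) ↔ _
  rw [← hd y.1]
  constructor
  · rintro ⟨hv, h⟩
    have hv' : y.2 ≠ 0 := fun h0 => hv (by rw [h0, Matrix.mulVec_zero])
    exact ⟨hv', SL2act_injective _ h⟩
  · rintro ⟨hv, h⟩
    exact ⟨SL2_mulVec_ne_zero _ hv, by rw [← h, SL2act_mk]⟩

/-- Every orbit carries a solution of the cocycle dynamics spanning a given invariant section. -/
theorem IsInvariantSection.exists_orbit {X : Type*} [TopologicalSpace X] {T : X ≃ₜ X} {A : X → SL2}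
    {d : C(X, RP1)} (hd : IsInvariantSection T A d) (x : X) :
    ∃ U : ℤ → Fin 2 → ℝ, (∀ n, U (n + 1) = (A ((T.toEquiv ^ n) x)).1.mulVec (U n)) ∧
      ∀ n, Spans (U n) (d ((T.toEquiv ^ n) x)) := by
  obtain ⟨v, hv⟩ := exists_spans (d x)
  have hfst : ∀ n : ℤ, ((skewProduct T A ^ n) (x, v)).1 = (T.toEquiv ^ n) x := fun n => by
    induction n with
    | zero => simp
    | succ n ih =>
      rw [add_comm, zpow_one_add, zpow_one_add, Equiv.Perm.mul_apply, Equiv.Perm.mul_apply, ← ih]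
      rfl
    | pred n ih =>
      rw [sub_eq_add_neg, add_comm, zpow_add, zpow_add, Equiv.Perm.mul_apply,
        Equiv.Perm.mul_apply, ← ih, zpow_neg_one, zpow_neg_one]
      rfl
  refine ⟨fun n => ((skewProduct T A ^ n) (x, v)).2, fun n => ?_, fun n => ?_⟩
  · beta_reduce
    rw [add_comm, zpow_one_add, Equiv.Perm.mul_apply, ← hfst n]
    rfl
  · beta_reduce
    rw [← hfst n]
    induction n with
    | zero => simpa using hv
    | succ n ih =>
      rw [add_comm, zpow_one_add, Equiv.Perm.mul_apply]
      exact (hd.spans_iff _).2 ih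
    | pred n ih =>
      rw [← hd.spans_iff, ← Equiv.Perm.mul_apply, ← zpow_one_add]
      simpa using ih

theorem cocIterZ_neg_mulVec_orbit {X : Type*} [TopologicalSpace X] {T : X ≃ₜ X} {A : X → SL2} {x : X}
    {U : ℤ → Fin 2 → ℝ} (hU : ∀ n, U (n + 1) = (A ((T.toEquiv ^ n) x)).1.mulVec (U n))
    (n : ℤ) (k : ℕ) :
    (cocIterZ T A (-(k : ℤ)) ((T.toEquiv ^ n) x)).1.mulVec (U n) = U (n - k) := by
  have hiter : ∀ (j : ℕ) (m : ℤ), T^[j] ((T.toEquiv ^ m) x) = (T.toEquiv ^ (m + j)) x := by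
    intro j m
    induction j with
    | zero => simp
    | succ j ih =>
      rw [Function.iterate_succ_apply', ih, Nat.cast_succ, ← add_assoc, add_comm (m + j),
        zpow_one_add]
      rfl
  have hfwd : ∀ (j : ℕ) (m : ℤ),
      (cocIterN T A j ((T.toEquiv ^ m) x)).1.mulVec (U m) = U (m + j) := by
    intro j m
    induction j with
    | zero => simp [cocIterN]
    | succ j ih =>
      rw [cocIterN, Matrix.SpecialLinearGroup.coe_mul, ← Matrix.mulVec_mulVec, ih, hiter,
        ← hU]
      push_cast
      rw [add_assoc]
  have hsymm : (⇑T.symm)^[k] ((T.toEquiv ^ n) x) = (T.toEquiv ^ (n - k)) x := by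
    have h := hiter k (n - k)
    rw [sub_add_cancel] at h
    rw [← h]
    exact (Function.LeftInverse.iterate T.symm_apply_apply k) _
  have hback : ((cocIterN T A k ((⇑T.symm)^[k] ((T.toEquiv ^ n) x)))⁻¹).1.mulVec (U n) =
      U (n - k) := by
    have h := hfwd k (n - k)
    rw [sub_add_cancel] at h
    rw [hsymm, ← h, Matrix.mulVec_mulVec, ← Matrix.SpecialLinearGroup.coe_mul, inv_mul_cancel]
    simp
  rcases Nat.eq_zero_or_pos k with rfl | hk
  · simp [cocIterZ, cocIterN]
  · rw [cocIterZ, if_neg (by omega), neg_neg, Int.toNat_natCast]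
    exact hback

theorem schrodingerCocycle_mulVec {X : Type*} (f : X → ℝ) (E : ℝ) (x : X) (v : Fin 2 → ℝ) :
    (schrodingerCocycle f E x).1.mulVec v = ![(E - f x) * v 0 - v 1, v 0] := by
  ext i
  fin_cases i
  · simp [schrodingerCocycle, Matrix.mulVec, dotProduct, Fin.sum_univ_two]
    ring
  · simp [schrodingerCocycle, Matrix.mulVec, dotProduct, Fin.sum_univ_two]

theorem schrodingerCocycle_orbit {X : Type*} [TopologicalSpace X] {T : X ≃ₜ X} {f : X → ℝ} {E : ℝ}
    {x : X} {U : ℤ → Fin 2 → ℝ}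
    (hU : ∀ n, U (n + 1) = (schrodingerCocycle f E ((T.toEquiv ^ n) x)).1.mulVec (U n)) :
    (∀ n, U (n + 1) 0 = (E - f ((T.toEquiv ^ n) x)) * U n 0 - U (n - 1) 0) ∧
      ∀ n, U (n - 1) 0 = U n 1 := by
  have hprev : ∀ n, U (n - 1) 0 = U n 1 := fun n => by
    have := hU (n - 1)
    rw [sub_add_cancel, schrodingerCocycle_mulVec] at this
    rw [this]
    rfl
  exact ⟨fun n => by rw [hU, schrodingerCocycle_mulVec, hprev]; rfl, hprev⟩

/-- The energy of a Schrödinger cocycle with an unstable section is not in the spectrum. -/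
theorem IsUnstableSection.notMem_spectrum {X : Type*} [TopologicalSpace X] [CompactSpace X]
    {T : X ≃ₜ X} {f : C(X, ℝ)} {E : ℝ} {d : C(X, RP1)}
    (hd : IsUnstableSection T (schrodingerCocycle f E) d) {x : X}
    {S : lp (fun _ : ℤ => ℝ) 2 →L[ℝ] lp (fun _ : ℤ => ℝ) 2} (hsa : IsSelfAdjoint S)
    (hS : ∀ ψ n, (S ψ) n = ψ (n + 1) + ψ (n - 1) + f ((T.toEquiv ^ n) x) * ψ n) :
    E ∉ spectrum ℝ S := by
  obtain ⟨hinv, C, -, l, hl, hdecay⟩ := hd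
  obtain ⟨U, hU, hspan⟩ := hinv.exists_orbit x
  obtain ⟨hrec, hprev⟩ := schrodingerCocycle_orbit hU
  have hl0 : 0 < l := by linarith
  obtain ⟨c, hc, hbound⟩ := exists_norm_sub_smul_ge_of_decay (S := S) (E := E) (C := C)
    (w := fun n => f ((T.toEquiv ^ n) x)) (u := fun n => U n 0) (M := fun n => ‖U n‖)
    (F := |E| + ‖f‖) hS hl hrec (fun n => norm_pos_iff.2 (hspan n).1)
    (fun n => norm_le_pi_norm (U n) 0)
    (fun n => by rw [hprev]; exact norm_le_pi_norm (U n) 1)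
    (fun n => by
      rw [hprev]
      refine Real.le_sqrt' (norm_pos_iff.2 (hspan n).1) |>.1 ?_
      refine (pi_norm_le_iff_of_nonneg (Real.sqrt_nonneg _)).2 fun i => ?_
      refine Real.le_sqrt_of_sq_le ?_
      rw [Real.norm_eq_abs, sq_abs]
      fin_cases i <;> simp [sq_nonneg])
    (fun n k => by
      obtain ⟨hv, h⟩ := hspan n
      have := hdecay _ k _ hv h
      rw [cocIterZ_neg_mulVec_orbit hU] at this
      calc l ^ k * ‖U (n - k)‖ ≤ l ^ k * (C * (l ^ k)⁻¹ * ‖U n‖) := by gcongr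
        _ = C * ‖U n‖ := by field_simp)
    (fun n => (abs_sub _ _).trans (add_le_add le_rfl (f.norm_coe_le_norm _)))
  exact notMem_spectrum_of_norm_sub_smul_ge hsa hc hbound


theorem cos_sin_ne_zero (θ : ℝ) : (![Real.cos θ, Real.sin θ] : Fin 2 → ℝ) ≠ 0 := by
  intro h
  have h0 : Real.cos θ = 0 := congrFun h 0
  have h1 : Real.sin θ = 0 := congrFun h 1
  have := Real.sin_sq_add_cos_sq θ
  rw [h0, h1] at this
  norm_num at this

/-- The line through the origin at angle `θ`. -/
def angleLine (θ : ℝ) : RP1 :=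
  Projectivization.mk ℝ ![Real.cos θ, Real.sin θ] (cos_sin_ne_zero θ)

theorem spans_angleLine_iff {v : Fin 2 → ℝ} {θ : ℝ} :
    Spans v (angleLine θ) ↔ ∃ r ≠ 0, v 0 = r * Real.cos θ ∧ v 1 = r * Real.sin θ := by
  constructor
  · rintro ⟨hv, h⟩
    obtain ⟨r, rfl⟩ := (Projectivization.mk_eq_mk_iff' ℝ _ _ _ _).1 h
    refine ⟨r, ?_, by simp, by simp⟩
    rintro rfl
    simp at hv
  · rintro ⟨r, hr, h0, h1⟩
    have hv : v = r • ![Real.cos θ, Real.sin θ] := by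
      ext i
      fin_cases i <;> simp [h0, h1]
    subst hv
    exact ⟨smul_ne_zero hr (cos_sin_ne_zero θ), (Projectivization.mk_eq_mk_iff' ℝ _ _ _ _).2 ⟨r, rfl⟩⟩

theorem exists_angleLine_eq (p : RP1) : ∃ θ, angleLine θ = p := by
  obtain ⟨v, hv⟩ := exists_spans p
  have hz : (⟨v 0, v 1⟩ : ℂ) ≠ 0 := by
    intro h
    apply hv.1
    ext i
    fin_cases i
    · exact congrArg Complex.re h
    · exact congrArg Complex.im h
  have hs : Spans v (angleLine (Complex.arg ⟨v 0, v 1⟩)) :=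
    spans_angleLine_iff.2 ⟨‖(⟨v 0, v 1⟩ : ℂ)‖, norm_ne_zero_iff.2 hz,
      (Complex.norm_mul_cos_arg ⟨v 0, v 1⟩).symm, (Complex.norm_mul_sin_arg ⟨v 0, v 1⟩).symm⟩
  exact ⟨_, hs.2.symm.trans hv.2⟩

theorem angleLine_eq_iff {θ η : ℝ} :
    angleLine θ = angleLine η ↔ ∃ k : ℤ, θ = η + k * Real.pi := by
  have h : angleLine θ = angleLine η ↔ Spans ![Real.cos θ, Real.sin θ] (angleLine η) :=
    ⟨fun h => ⟨cos_sin_ne_zero θ, h⟩, fun h => h.2⟩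
  rw [h, spans_angleLine_iff]
  constructor
  · rintro ⟨r, -, h0, h1⟩
    have hs : Real.sin (θ - η) = 0 := by
      simp only [Matrix.cons_val_zero, Matrix.cons_val_one] at h0 h1
      rw [Real.sin_sub, h0, h1]
      ring
    obtain ⟨k, hk⟩ := Real.sin_eq_zero_iff.1 hs
    exact ⟨k, by linarith⟩
  · rintro ⟨k, rfl⟩
    exact ⟨(-1) ^ k, zpow_ne_zero _ (by norm_num), by simp [Real.cos_add_int_mul_pi],
      by simp [Real.sin_add_int_mul_pi]⟩

/-- The map from the projective line to the circle doubling angles. -/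
def doubleAngle : RP1 → Circle :=
  Projectivization.lift
    (fun v => Circle.ofConjDivSelf ⟨v.1 0, -v.1 1⟩ fun h => v.2 <| by
      ext i
      fin_cases i
      · exact congrArg Complex.re h
      · exact neg_eq_zero.1 (congrArg Complex.im h))
    (by
      rintro ⟨v, hv⟩ ⟨w, hw⟩ t rfl
      have ht : (t : ℂ) ≠ 0 := by
        rintro h
        apply hv
        rw [Complex.ofReal_eq_zero.1 h, zero_smul]
      ext1
      have hz : (⟨(t • w) 0, -(t • w) 1⟩ : ℂ) = t * ⟨w 0, -w 1⟩ := by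
        apply Complex.ext <;> simp
      change (starRingEnd ℂ) ⟨(t • w) 0, -(t • w) 1⟩ / (⟨(t • w) 0, -(t • w) 1⟩ : ℂ) = _
      rw [hz, map_mul, Complex.conj_ofReal, mul_div_mul_left _ _ ht]
      rfl)

theorem continuous_doubleAngle : Continuous doubleAngle := by
  refine Continuous.quotient_lift ?_ _
  refine Continuous.subtype_mk ?_ _
  have h : Continuous fun v : { v : Fin 2 → ℝ // v ≠ 0 } => (⟨v.1 0, -v.1 1⟩ : ℂ) := by
    refine Complex.equivRealProdCLM.symm.continuous.comp (f := fun v : { v : Fin 2 → ℝ // v ≠ 0 } =>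
      (v.1 0, -v.1 1)) ?_
    exact ((continuous_apply 0).comp continuous_subtype_val).prodMk
      ((continuous_apply 1).comp continuous_subtype_val).neg
  refine (Complex.continuous_conj.comp h).div h ?_
  rintro ⟨v, hv⟩ h0
  apply hv
  ext i
  fin_cases i
  · exact congrArg Complex.re h0
  · exact neg_eq_zero.1 (congrArg Complex.im h0)

theorem doubleAngle_angleLine (θ : ℝ) : doubleAngle (angleLine θ) = Circle.exp (2 * θ) := by
  ext1
  change (starRingEnd ℂ) ⟨Real.cos θ, -Real.sin θ⟩ / (⟨Real.cos θ, -Real.sin θ⟩ : ℂ) = _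
  have hz : (⟨Real.cos θ, -Real.sin θ⟩ : ℂ) = Complex.exp (-(θ * Complex.I)) := by
    rw [← neg_mul, ← Complex.ofReal_neg, Complex.exp_mul_I, ← Complex.ofReal_cos,
      ← Complex.ofReal_sin]
    apply Complex.ext <;> simp [-Complex.ofReal_cos, -Complex.ofReal_sin]
  rw [hz, ← Complex.exp_conj, ← Complex.exp_sub, Circle.coe_exp]
  congr 1
  simp
  ring

/-- Homotopic maps to the projective line differ by a continuous angle. -/
theorem exists_angle_of_homotopic {X : Type*} [TopologicalSpace X] {d₁ d₂ : C(X, RP1)}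
    (h : d₁.Homotopic d₂) :
    ∃ a : X → ℝ, Continuous a ∧ ∀ x θ, d₁ x = angleLine θ → d₂ x = angleLine (θ + a x) := by
  obtain ⟨F⟩ := h
  let G : C(unitInterval × X, Circle) :=
    ⟨fun y => doubleAngle (F y) / doubleAngle (d₁ y.2),
      (continuous_doubleAngle.comp F.continuous).div'
        (continuous_doubleAngle.comp (d₁.continuous.comp continuous_snd))⟩
  have hG0 : ∀ x, G (0, x) = Circle.exp ((ContinuousMap.const X (0 : ℝ)) x) := fun x => by
    simp [G]
  let L := Circle.isCoveringMap_exp.liftHomotopy G (ContinuousMap.const X 0) hG0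
  refine ⟨fun x => L (1, x) / 2, by fun_prop, fun x θ hθ => ?_⟩
  have hL : Circle.exp (L (1, x)) = doubleAngle (d₂ x) / doubleAngle (d₁ x) := by
    have := congrFun (Circle.isCoveringMap_exp.liftHomotopy_lifts G (ContinuousMap.const X 0) hG0)
      (1, x)
    refine this.trans ?_
    simp [G]
  obtain ⟨η, hη⟩ := exists_angleLine_eq (d₂ x)
  rw [← hη, hθ, doubleAngle_angleLine, doubleAngle_angleLine, ← Circle.exp_sub,
    Circle.exp_eq_exp] at hL
  obtain ⟨m, hm⟩ := hL
  rw [← hη, angleLine_eq_iff]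
  exact ⟨-m, by push_cast; linarith⟩

/-- The angle by which the shear of strength `s` moves the vector `(cos θ, sin θ)`, as a function
of `z = exp (2 * I * θ)`. -/
def shearAngle (s : ℝ) (z : ℂ) : ℝ :=
  Complex.arg ⟨1 + s * (z.im / 2), -(s * ((1 - z.re) / 2))⟩

theorem shear_mem_slitPlane (s : ℝ) {z : ℂ} (hz : ‖z‖ = 1) :
    (⟨1 + s * (z.im / 2), -(s * ((1 - z.re) / 2))⟩ : ℂ) ∈ Complex.slitPlane := by
  rw [Complex.mem_slitPlane_iff]
  by_cases h : -(s * ((1 - z.re) / 2)) = 0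
  · left
    have h1 : s = 0 ∨ z.re = 1 := by
      rcases mul_eq_zero.1 (neg_eq_zero.1 h) with h | h
      · exact Or.inl h
      · right; linarith
    have h2 : s * (z.im / 2) = 0 := by
      rcases h1 with h1 | h1
      · rw [h1, zero_mul]
      · have := Complex.sq_norm z
        rw [hz, Complex.normSq_apply, h1] at this
        have : z.im = 0 := by nlinarith
        rw [this]
        ring
    change 0 < 1 + s * (z.im / 2)
    rw [h2]
    norm_num
  · exact Or.inr h

theorem Continuous.shearAngle {Y : Type*} [TopologicalSpace Y] {s : Y → ℝ} {z : Y → ℂ}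
    (hs : Continuous s) (hz : Continuous z) (h : ∀ y, ‖z y‖ = 1) :
    Continuous fun y => shearAngle (s y) (z y) := by
  have hw : Continuous fun y =>
      (⟨1 + s y * ((z y).im / 2), -(s y * ((1 - (z y).re) / 2))⟩ : ℂ) := by
    refine Complex.equivRealProdCLM.symm.continuous.comp
      (f := fun y => (1 + s y * ((z y).im / 2), -(s y * ((1 - (z y).re) / 2)))) ?_
    fun_prop
  rw [continuous_iff_continuousAt]
  exact fun y => (Complex.continuousAt_arg (shear_mem_slitPlane (s y) (h y))).comp
    (f := fun y => (⟨1 + s y * ((z y).im / 2), -(s y * ((1 - (z y).re) / 2))⟩ : ℂ))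
    hw.continuousAt

/-- A lift to the line of the action of the shear `(p, q) ↦ (p + s q, q)` on angles. -/
def shearLift (s θ : ℝ) : ℝ := θ + shearAngle s (Circle.exp (2 * θ))

theorem continuous_shearLift (s : ℝ) : Continuous (shearLift s) :=
  continuous_id.add (Continuous.shearAngle continuous_const (by fun_prop) fun _ => Circle.norm_coe _)

theorem shearLift_spec (s θ : ℝ) : ∃ ρ > 0,
    Real.cos θ + s * Real.sin θ = ρ * Real.cos (shearLift s θ) ∧
      Real.sin θ = ρ * Real.sin (shearLift s θ) := by
  have hz := shear_mem_slitPlane s (Circle.norm_coe (Circle.exp (2 * θ)))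
  have hcos := Complex.norm_mul_cos_arg
    ⟨1 + s * ((Circle.exp (2 * θ) : ℂ).im / 2), -(s * ((1 - (Circle.exp (2 * θ) : ℂ).re) / 2))⟩
  have hsin := Complex.norm_mul_sin_arg
    ⟨1 + s * ((Circle.exp (2 * θ) : ℂ).im / 2), -(s * ((1 - (Circle.exp (2 * θ) : ℂ).re) / 2))⟩
  refine ⟨_, norm_pos_iff.2 (Complex.slitPlane_ne_zero hz), ?_⟩
  have hexp : (Circle.exp (2 * θ) : ℂ) = ⟨Real.cos (2 * θ), Real.sin (2 * θ)⟩ := by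
    rw [Circle.coe_exp, Complex.exp_mul_I, ← Complex.ofReal_cos, ← Complex.ofReal_sin]
    apply Complex.ext <;> simp [-Complex.ofReal_cos, -Complex.ofReal_sin]
  have h1 := Real.sin_sq_add_cos_sq θ
  have hc : (Circle.exp (2 * θ) : ℂ).re = 1 - 2 * Real.sin θ ^ 2 := by
    rw [hexp]
    change Real.cos (2 * θ) = _
    rw [Real.cos_two_mul]
    linarith
  have hs : (Circle.exp (2 * θ) : ℂ).im = 2 * Real.sin θ * Real.cos θ := by
    rw [hexp]
    exact Real.sin_two_mul θ
  unfold shearLift shearAngle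
  rw [Real.cos_add, Real.sin_add]
  generalize ‖(⟨1 + s * ((Circle.exp (2 * θ) : ℂ).im / 2),
    -(s * ((1 - (Circle.exp (2 * θ) : ℂ).re) / 2))⟩ : ℂ)‖ = ρ at *
  generalize Complex.arg (⟨1 + s * ((Circle.exp (2 * θ) : ℂ).im / 2),
    -(s * ((1 - (Circle.exp (2 * θ) : ℂ).re) / 2))⟩ : ℂ) = α at *
  simp only [hc, hs] at hcos hsin
  constructor
  · linear_combination -(Real.cos θ) * hcos + Real.sin θ * hsin - s * Real.sin θ * h1
  · linear_combination -(Real.sin θ) * hcos - Real.cos θ * hsin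

theorem shearLift_add_int_mul_pi (s θ : ℝ) (j : ℤ) :
    shearLift s (θ + j * Real.pi) = shearLift s θ + j * Real.pi := by
  have : Circle.exp (2 * (θ + j * Real.pi)) = Circle.exp (2 * θ) :=
    Circle.exp_eq_exp.2 ⟨j, by ring⟩
  rw [shearLift, shearLift, this]
  ring

theorem shearLift_int_mul_pi (s : ℝ) (j : ℤ) : shearLift s (j * Real.pi) = j * Real.pi := by
  have h0 : shearLift s 0 = 0 := by
    have : Complex.arg ⟨1, 0⟩ = 0 := Complex.arg_one
    simp [shearLift, shearAngle, this]
  simpa [h0] using shearLift_add_int_mul_pi s 0 j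

theorem shearLift_strictMono (s : ℝ) : StrictMono (shearLift s) := by
  have hinj : Function.Injective (shearLift s) := by
    intro θ η h
    obtain ⟨ρ, hρ, hc, hs⟩ := shearLift_spec s θ
    obtain ⟨ρ', hρ', hc', hs'⟩ := shearLift_spec s η
    have hsin : Real.sin (θ - η) = 0 := by
      rw [Real.sin_sub]
      rw [h] at hc hs
      have : Real.sin θ * (Real.cos η + s * Real.sin η) =
          (Real.cos θ + s * Real.sin θ) * Real.sin η := by
        rw [hc', hc, hs, hs']
        ring
      linarith
    obtain ⟨j, hj⟩ := Real.sin_eq_zero_iff.1 hsin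
    have hθ : θ = η + j * Real.pi := by linarith
    rw [hθ, shearLift_add_int_mul_pi] at h
    rw [hθ]
    linarith
  refine ((continuous_shearLift s).strictMono_of_inj hinj).resolve_right fun h => ?_
  have h0 := shearLift_int_mul_pi s 0
  have h1 := shearLift_int_mul_pi s 1
  have := h (show ((0 : ℤ) : ℝ) * Real.pi < ((1 : ℤ) : ℝ) * Real.pi by simp [Real.pi_pos])
  rw [h0, h1] at this
  simp at this
  linarith [Real.pi_pos]

theorem shearLift_lt_shearLift {s₁ s₂ : ℝ} (hs : s₁ < s₂) {θ : ℝ} (hθ : Real.sin θ ≠ 0) :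
    shearLift s₂ θ < shearLift s₁ θ ∧ shearLift s₁ θ < shearLift s₂ θ + Real.pi := by
  have hpi := Real.pi_pos
  set m := ⌊θ / Real.pi⌋ with hm
  have h1 : m * Real.pi < θ := by
    refine lt_of_le_of_ne ((le_div_iff₀ hpi).1 (Int.floor_le _)) fun h => hθ ?_
    rw [← h, Real.sin_int_mul_pi]
  have h2 : θ < ((m + 1 : ℤ) : ℝ) * Real.pi :=
    (div_lt_iff₀ hpi).1 (by push_cast; exact Int.lt_floor_add_one _)
  have hlow : ∀ s, m * Real.pi < shearLift s θ := fun s => by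
    have := shearLift_strictMono s h1
    rwa [shearLift_int_mul_pi] at this
  have hup : ∀ s, shearLift s θ < (m + 1) * Real.pi := fun s => by
    have := shearLift_strictMono s h2
    rw [shearLift_int_mul_pi] at this
    exact_mod_cast this
  have l1 := hlow s₁
  have l2 := hlow s₂
  have u1 := hup s₁
  have u2 := hup s₂
  refine ⟨?_, by linarith⟩
  by_contra! hle
  have hsin : Real.sin (shearLift s₁ θ - shearLift s₂ θ) ≤ 0 :=
    Real.sin_nonpos_of_nonpos_of_neg_pi_le (by linarith) (by linarith)
  obtain ⟨ρ₁, hρ₁, hc₁, hs₁⟩ := shearLift_spec s₁ θ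
  obtain ⟨ρ₂, hρ₂, hc₂, hs₂⟩ := shearLift_spec s₂ θ
  have hkey : ρ₁ * ρ₂ * Real.sin (shearLift s₁ θ - shearLift s₂ θ) =
      (s₂ - s₁) * Real.sin θ ^ 2 := by
    have : ρ₁ * ρ₂ * Real.sin (shearLift s₁ θ - shearLift s₂ θ) =
        (ρ₁ * Real.sin (shearLift s₁ θ)) * (ρ₂ * Real.cos (shearLift s₂ θ)) -
          (ρ₁ * Real.cos (shearLift s₁ θ)) * (ρ₂ * Real.sin (shearLift s₂ θ)) := by
      rw [Real.sin_sub]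
      ring
    rw [this, ← hc₁, ← hs₁, ← hc₂, ← hs₂]
    ring
  have hpos : 0 < (s₂ - s₁) * Real.sin θ ^ 2 := mul_pos (sub_pos.2 hs) (by positivity)
  nlinarith [mul_pos hρ₁ hρ₂]

theorem shearLift_le_shearLift {s₁ s₂ : ℝ} (hs : s₁ < s₂) (θ : ℝ) :
    shearLift s₂ θ ≤ shearLift s₁ θ ∧ shearLift s₁ θ < shearLift s₂ θ + Real.pi := by
  by_cases hθ : Real.sin θ = 0
  · obtain ⟨j, rfl⟩ := Real.sin_eq_zero_iff.1 hθ
    rw [shearLift_int_mul_pi, shearLift_int_mul_pi]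
    exact ⟨le_rfl, by linarith [Real.pi_pos]⟩
  · exact ⟨(shearLift_lt_shearLift hs hθ).1.le, (shearLift_lt_shearLift hs hθ).2⟩

theorem forall_neg_or_forall_pos_of_ergodic {X : Type*} [TopologicalSpace X] [MeasurableSpace X]
    [OpensMeasurableSpace X] {T : X ≃ₜ X} {μ : Measure X} [IsFiniteMeasure μ] (hT : Ergodic T μ)
    (hfull : ∀ U : Set X, IsOpen U → U.Nonempty → μ U ≠ 0) {b : X → ℝ} (hb : Continuous b)
    (h1 : ∀ x, b x ≤ 0 → b (T x) ≤ 0) (h2 : ∀ x, b x ≤ 0 → b (T (T x)) < 0) :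
    (∀ x, b x < 0) ∨ ∀ x, 0 < b x := by
  have hclosed : IsClosed {x | b x ≤ 0} := isClosed_le hb continuous_const
  rcases hT.ae_empty_or_univ_of_ae_le_preimage hclosed.measurableSet.nullMeasurableSet
    (Filter.Eventually.of_forall h1) with h | h
  · right
    have hU : IsOpen {x | b x < 0} := isOpen_lt hb continuous_const
    have hnull : μ {x | b x < 0} = 0 :=
      measure_mono_null (t := {x | b x ≤ 0}) (fun x (hx : b x < 0) => hx.le)
        (ae_eq_empty (s := {x | b x ≤ 0}).1 h)
    intro x
    by_contra! hx
    exact hfull _ hU ⟨_, h2 x hx⟩ hnull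
  · left
    have hle : ∀ x, b x ≤ 0 := by
      intro x
      by_contra! hx
      exact hfull _ hclosed.isOpen_compl ⟨x, not_le.2 hx⟩ (ae_eq_univ (s := {x | b x ≤ 0}).1 h)
    intro x
    obtain ⟨y, rfl⟩ := T.surjective x
    obtain ⟨z, rfl⟩ := T.surjective y
    exact h2 z (hle z)

/-- Dynamics of the relative angle `a` between two invariant sections whose cocycles are shears of
different strengths. -/
theorem exists_strip_of_shearLift {X : Type*} [TopologicalSpace X] [CompactSpace X] [Nonempty X]
    [MeasurableSpace X] [OpensMeasurableSpace X] {T : X ≃ₜ X} {μ : Measure X} [IsFiniteMeasure μ]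
    (hT : Ergodic T μ) (hfull : ∀ U : Set X, IsOpen U → U.Nonempty → μ U ≠ 0)
    {a θ s₁ s₂ : X → ℝ} {k : ℤ} (ha : Continuous a) (hs : ∀ x, s₁ x < s₂ x)
    (haT : ∀ x, a (T x) =
      shearLift (s₂ x) (θ x + a x) - shearLift (s₁ x) (θ x) + k * Real.pi)
    (hθ : ∀ x, Real.sin (θ x) = 0 → Real.sin (θ (T x)) ≠ 0) :
    (k = 0 ∨ k = 1) ∧ ∃ m : ℤ, ∀ x, m * Real.pi < a x ∧ a x < (m + 1) * Real.pi := by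
  have hpi := Real.pi_pos
  have hle : ∀ x (m : ℤ), a x ≤ m * Real.pi → a (T x) ≤ (m + k) * Real.pi := fun x m h => by
    have hmono := (shearLift_strictMono (s₂ x)).monotone (add_le_add_right h (θ x))
    rw [shearLift_add_int_mul_pi] at hmono
    linarith [haT x, (shearLift_le_shearLift (hs x) (θ x)).1]
  have hlt : ∀ x (m : ℤ), a x < m * Real.pi → a (T x) < (m + k) * Real.pi := fun x m h => by
    have hmono := shearLift_strictMono (s₂ x) (add_lt_add_right h (θ x))
    rw [shearLift_add_int_mul_pi] at hmono
    linarith [haT x, (shearLift_le_shearLift (hs x) (θ x)).1]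
  have hlt' : ∀ x (m : ℤ), Real.sin (θ x) ≠ 0 → a x ≤ m * Real.pi →
      a (T x) < (m + k) * Real.pi := fun x m h0 h => by
    have hmono := (shearLift_strictMono (s₂ x)).monotone (add_le_add_right h (θ x))
    rw [shearLift_add_int_mul_pi] at hmono
    linarith [haT x, (shearLift_lt_shearLift (hs x) h0).1]
  have hgt : ∀ x (m : ℤ), m * Real.pi ≤ a x → (m - 1 + k) * Real.pi < a (T x) := fun x m h => by
    have hmono := (shearLift_strictMono (s₂ x)).monotone (add_le_add_right h (θ x))
    rw [shearLift_add_int_mul_pi] at hmono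
    linarith [haT x, (shearLift_le_shearLift (hs x) (θ x)).2]
  have hk1 : k ≤ 1 := by
    by_contra! hk
    obtain ⟨y, -, hy⟩ := isCompact_univ.exists_isMaxOn Set.univ_nonempty ha.continuousOn
    have hk' : (2 : ℝ) ≤ k := by exact_mod_cast hk
    have h1 := hgt y _ ((le_div_iff₀ hpi).1 (Int.floor_le (a y / Real.pi)))
    have h2 := (div_lt_iff₀ hpi).1 (Int.lt_floor_add_one (a y / Real.pi))
    have h3 : a (T y) ≤ a y := hy (Set.mem_univ _)
    nlinarith
  have hk0 : 0 ≤ k := by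
    by_contra! hk
    obtain ⟨y, -, hy⟩ := isCompact_univ.exists_isMinOn Set.univ_nonempty ha.continuousOn
    have hk' : (k : ℝ) ≤ -1 := by exact_mod_cast Int.le_sub_one_of_lt hk
    have h1 := hle y _ ((div_le_iff₀ hpi).1 (Int.le_ceil (a y / Real.pi)))
    have h2 := (lt_div_iff₀ hpi).1 (sub_lt_iff_lt_add.2 (Int.ceil_lt_add_one (a y / Real.pi)))
    have h3 : a y ≤ a (T y) := hy (Set.mem_univ _)
    nlinarith
  have hk : k = 0 ∨ k = 1 := by omega
  have hdich : ∀ m : ℤ, (∀ x, a x < m * Real.pi) ∨ ∀ x, m * Real.pi < a x := fun m => by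
    rcases hk with rfl | rfl
    · have := forall_neg_or_forall_pos_of_ergodic hT hfull (b := fun x => a x - m * Real.pi)
        (ha.sub continuous_const)
        (fun x h => by
          have := hle x m (by linarith)
          push_cast at this
          linarith)
        (fun x h => by
          have h' : a x ≤ m * Real.pi := by linarith
          have : a (T (T x)) < (m + (0 : ℤ)) * Real.pi := by
            by_cases h0 : Real.sin (θ x) = 0
            · exact hlt' _ m (hθ x h0) (by simpa using hle x m h')
            · exact hlt _ m (by simpa using hlt' x m h0 h')
          push_cast at this
          linarith)
      simpa only [sub_neg, sub_pos] using this
    · have hstep : ∀ x, m * Real.pi ≤ a x → m * Real.pi < a (T x) := fun x h => by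
        have := hgt x m h
        push_cast at this
        linarith
      have := forall_neg_or_forall_pos_of_ergodic hT hfull (b := fun x => m * Real.pi - a x)
        (continuous_const.sub ha)
        (fun x h => by linarith [hstep x (by linarith)])
        (fun x h => by linarith [hstep (T x) (hstep x (by linarith)).le])
      simpa only [sub_neg, sub_pos] using this.symm
  refine ⟨hk, ?_⟩
  obtain ⟨x₀⟩ := ‹Nonempty X›
  set m := ⌊a x₀ / Real.pi⌋ with hm
  have h1 : m * Real.pi ≤ a x₀ := (le_div_iff₀ hpi).1 (Int.floor_le _)
  have h2 : a x₀ < (m + 1) * Real.pi := (div_lt_iff₀ hpi).1 (Int.lt_floor_add_one _)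
  refine ⟨m, fun x => ⟨((hdich m).resolve_left fun h => ?_) x, ?_⟩⟩
  · linarith [h x₀]
  · have := ((hdich (m + 1)).resolve_right fun h => ?_) x
    · exact_mod_cast this
    · have := h x₀
      push_cast at this
      linarith

theorem SL2act_schrodingerCocycle_angleLine {X : Type*} (f : X → ℝ) (E : ℝ) (x : X) (α : ℝ) :
    SL2act (schrodingerCocycle f E x) (angleLine α) =
      angleLine (shearLift (E - f x) (α + Real.pi / 2)) := by
  obtain ⟨ρ, hρ, hc, hs⟩ := shearLift_spec (E - f x) (α + Real.pi / 2)
  rw [Real.cos_add_pi_div_two, Real.sin_add_pi_div_two] at hc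
  rw [Real.sin_add_pi_div_two] at hs
  rw [angleLine, SL2act_mk]
  refine (spans_angleLine_iff.2 ⟨ρ, hρ.ne', ?_, ?_⟩ : Spans _ _).2
  · rw [← hc, schrodingerCocycle_mulVec]
    simp
    ring
  · rw [← hs, schrodingerCocycle_mulVec]
    simp

/-- Vectors spanning two homotopic invariant sections at different energies have Wronskians of
constant or of alternating sign along every orbit. -/
theorem wronskian_sign_of_homotopic {X : Type*} [TopologicalSpace X] [CompactSpace X]
    [ConnectedSpace X] [MeasurableSpace X] [OpensMeasurableSpace X] {T : X ≃ₜ X} {μ : Measure X}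
    [IsFiniteMeasure μ] (hT : Ergodic T μ)
    (hfull : ∀ U : Set X, IsOpen U → U.Nonempty → μ U ≠ 0) {f : C(X, ℝ)} {E₁ E₂ : ℝ} (hE : E₁ < E₂)
    {d₁ d₂ : C(X, RP1)} (hd₁ : IsInvariantSection T (schrodingerCocycle f E₁) d₁)
    (hd₂ : IsInvariantSection T (schrodingerCocycle f E₂) d₂) (h : d₁.Homotopic d₂) :
    ∃ ε : ℝ, (ε = 1 ∨ ε = -1) ∧ ∀ x v₁ v₂, Spans v₁ (d₁ x) → Spans v₂ (d₂ x) →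
      0 < ε * ((v₁ 0 * v₂ 1 - v₁ 1 * v₂ 0) *
        (((E₁ - f x) * v₁ 0 - v₁ 1) * v₂ 0 - v₁ 0 * ((E₂ - f x) * v₂ 0 - v₂ 1))) := by
  obtain ⟨a, ha, had⟩ := exists_angle_of_homotopic h
  choose α hα using fun x => exists_angleLine_eq (d₁ x)
  have hα₂ : ∀ x, d₂ x = angleLine (α x + a x) := fun x => had x _ (hα x).symm
  have hd₁T : ∀ x, d₁ (T x) = angleLine (shearLift (E₁ - f x) (α x + Real.pi / 2)) := fun x => by
    rw [← hd₁ x, ← hα, SL2act_schrodingerCocycle_angleLine]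
  have hd₂T : ∀ x, d₂ (T x) = angleLine (shearLift (E₂ - f x) (α x + Real.pi / 2 + a x)) :=
    fun x => by
      rw [← hd₂ x, hα₂, SL2act_schrodingerCocycle_angleLine, add_right_comm]
  have hk : ∀ x, ∃ k : ℤ, a (T x) = shearLift (E₂ - f x) (α x + Real.pi / 2 + a x) -
      shearLift (E₁ - f x) (α x + Real.pi / 2) + k * Real.pi := fun x => by
    obtain ⟨k, hk⟩ := angleLine_eq_iff.1 ((had (T x) _ (hd₁T x)).symm.trans (hd₂T x))
    exact ⟨k, by linarith⟩
  choose k hk using hk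
  have hdbl₁ : ∀ x, (Circle.exp (2 * (α x + Real.pi / 2)) : ℂ) = -(doubleAngle (d₁ x) : ℂ) :=
    fun x => by
      rw [← hα, doubleAngle_angleLine, mul_add, mul_div_cancel₀ _ two_ne_zero, Circle.exp_add]
      simp
  have hdbl₂ : ∀ x, (Circle.exp (2 * (α x + Real.pi / 2 + a x)) : ℂ) =
      -(doubleAngle (d₂ x) : ℂ) := fun x => by
    rw [hα₂, doubleAngle_angleLine, add_right_comm, mul_add, mul_div_cancel₀ _ two_ne_zero,
      Circle.exp_add]
    simp
  have hkcont : Continuous fun x => (k x : ℝ) := by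
    have hform : ∀ x, (k x : ℝ) = (a (T x) - (a x +
        shearAngle (E₂ - f x) (-(doubleAngle (d₂ x) : ℂ)) -
          shearAngle (E₁ - f x) (-(doubleAngle (d₁ x) : ℂ)))) / Real.pi := fun x => by
      rw [eq_div_iff Real.pi_ne_zero, hk, shearLift, shearLift, hdbl₁, hdbl₂]
      ring
    have hdbl : ∀ d : C(X, RP1), Continuous fun x => -(doubleAngle (d x) : ℂ) := fun d =>
      (continuous_subtype_val.comp (continuous_doubleAngle.comp d.continuous)).neg
    have hang : ∀ (d : C(X, RP1)) (E : ℝ),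
        Continuous fun x => shearAngle (E - f x) (-(doubleAngle (d x) : ℂ)) := fun d E =>
      Continuous.shearAngle (continuous_const.sub f.continuous) (hdbl d) fun x => by
        rw [norm_neg, Circle.norm_coe]
    simp_rw [hform]
    exact ((ha.comp T.continuous).sub ((ha.add (hang d₂ E₂)).sub (hang d₁ E₁))).div_const _
  obtain ⟨x₀⟩ := (inferInstance : Nonempty X)
  have hkconst : ∀ x, k x = k x₀ := fun x =>
    PreconnectedSpace.constant inferInstance (Int.isClosedEmbedding_coe_real.continuous_iff.2 hkcont)
  have hsin : ∀ x, Real.sin (α x + Real.pi / 2) = 0 → Real.sin (α (T x) + Real.pi / 2) ≠ 0 := by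
    intro x h0
    obtain ⟨ρ, hρ, -, hs⟩ := shearLift_spec (E₁ - f x) (α x + Real.pi / 2)
    obtain ⟨j, hj⟩ := Real.sin_eq_zero_iff.1
      ((mul_eq_zero.1 (hs.symm.trans h0)).resolve_left hρ.ne')
    obtain ⟨i, hi⟩ := angleLine_eq_iff.1 ((hα (T x)).trans (hd₁T x))
    rw [hi, ← hj, Real.sin_add_pi_div_two, Real.cos_add_int_mul_pi, ← zero_add (j * Real.pi : ℝ),
      Real.cos_add_int_mul_pi, Real.cos_zero, mul_one]
    exact mul_ne_zero (zpow_ne_zero _ (by norm_num)) (zpow_ne_zero _ (by norm_num))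
  obtain ⟨hk01, m, hm⟩ := exists_strip_of_shearLift hT hfull (θ := fun x => α x + Real.pi / 2)
    (s₁ := fun x => E₁ - f x) (s₂ := fun x => E₂ - f x) (k := k x₀) ha
    (fun x => by linarith) (fun x => by rw [hk x, hkconst x]) hsin
  have hstrip : ∀ x, 0 < (-1) ^ m * Real.sin (a x) := fun x => by
    rw [← Real.sin_sub_int_mul_pi]
    exact Real.sin_pos_of_pos_of_lt_pi (by linarith [hm x]) (by linarith [hm x])
  have hprod : ∀ x, 0 < Real.sin (a x) * Real.sin (a (T x)) := fun x => by
    have hsq : ((-1 : ℝ) ^ m) * (-1) ^ m = 1 := by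
      rw [← mul_zpow]
      norm_num
    calc 0 < ((-1) ^ m * Real.sin (a x)) * ((-1) ^ m * Real.sin (a (T x))) :=
          mul_pos (hstrip x) (hstrip (T x))
      _ = ((-1) ^ m * (-1) ^ m) * (Real.sin (a x) * Real.sin (a (T x))) := by ring
      _ = _ := by rw [hsq, one_mul]
  refine ⟨(-1) ^ (k x₀), ?_, fun x v₁ v₂ h₁ h₂ => ?_⟩
  · rcases hk01 with h | h <;> simp [h]
  rw [← hα, spans_angleLine_iff] at h₁
  rw [hα₂, spans_angleLine_iff] at h₂
  obtain ⟨r₁, hr₁, h₁0, h₁1⟩ := h₁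
  obtain ⟨r₂, hr₂, h₂0, h₂1⟩ := h₂
  obtain ⟨ρ₁, hρ₁, hc₁, hs₁⟩ := shearLift_spec (E₁ - f x) (α x + Real.pi / 2)
  obtain ⟨ρ₂, hρ₂, hc₂, hs₂⟩ := shearLift_spec (E₂ - f x) (α x + Real.pi / 2 + a x)
  have hdet : v₁ 0 * v₂ 1 - v₁ 1 * v₂ 0 = r₁ * r₂ * Real.sin (a x) := by
    have : Real.sin (a x) = Real.sin ((α x + a x) - α x) := by ring_nf
    rw [this, Real.sin_sub, h₁0, h₁1, h₂0, h₂1]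
    ring
  have hdetT : ((E₁ - f x) * v₁ 0 - v₁ 1) * v₂ 0 - v₁ 0 * ((E₂ - f x) * v₂ 0 - v₂ 1) =
      r₁ * r₂ * ρ₁ * ρ₂ * ((-1) ^ (k x₀) * Real.sin (a (T x))) := by
    have hang : a (T x) - k x₀ * Real.pi = shearLift (E₂ - f x) (α x + Real.pi / 2 + a x) -
        shearLift (E₁ - f x) (α x + Real.pi / 2) := by
      rw [hk, hkconst]
      ring
    rw [← Real.sin_sub_int_mul_pi, hang, Real.sin_sub]
    have expand : ∀ c₁ c₂ t₁ t₂ : ℝ, r₁ * r₂ * ρ₁ * ρ₂ * (t₂ * c₁ - c₂ * t₁) =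
        r₁ * r₂ * ((ρ₁ * c₁) * (ρ₂ * t₂) - (ρ₁ * t₁) * (ρ₂ * c₂)) := fun c₁ c₂ t₁ t₂ => by ring
    rw [expand, ← hc₁, ← hc₂, ← hs₁, ← hs₂, add_right_comm, Real.cos_add_pi_div_two,
      Real.cos_add_pi_div_two, Real.sin_add_pi_div_two, Real.sin_add_pi_div_two, h₁0, h₁1, h₂0,
      h₂1]
    ring
  have hsq : ((-1 : ℝ) ^ (k x₀)) * (-1) ^ (k x₀) = 1 := by
    rw [← mul_zpow]
    norm_num
  have hcalc : (-1) ^ (k x₀) * (r₁ * r₂ * Real.sin (a x) *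
      (r₁ * r₂ * ρ₁ * ρ₂ * ((-1) ^ (k x₀) * Real.sin (a (T x))))) =
      (r₁ * r₂) ^ 2 * (ρ₁ * ρ₂) * (Real.sin (a x) * Real.sin (a (T x))) := by
    linear_combination (r₁ * r₂) ^ 2 * (ρ₁ * ρ₂) * (Real.sin (a x) * Real.sin (a (T x))) * hsq
  rw [hdet, hdetT, hcalc]
  have := hprod x
  positivity

/-- Assume `X` is connected and let `E₁ < E₂` be energies at which the
Schrödinger cocycles `(T, A_{E₁})` and `(T, A_{E₂})` are uniformly hyperbolic. Then either
`[E₁, E₂] ∩ Σ₀ = ∅`, or `Σ₀ ⊆ (E₁, E₂)`, or any unstable sections at `E₁` and at `E₂` are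
not homotopic. -/
theorem key_trichotomy
    {X : Type*} [MetricSpace X] [CompactSpace X] [Nonempty X] [ConnectedSpace X]
    [MeasurableSpace X] [BorelSpace X]
    -- `T` is a homeomorphism of `X`
    (T : X ≃ₜ X)
    -- `μ` is an ergodic Borel probability measure with full topological support
    (μ : Measure X) [IsProbabilityMeasure μ]
    (hT : Ergodic T μ)
    (hfull : ∀ U : Set X, IsOpen U → U.Nonempty → μ U ≠ 0)
    -- the continuous sampling function
    (f : C(X, ℝ))
    -- the unperturbed Schrödinger operators `H_x` on `ℓ²(ℤ)`
    (H : X → (lp (fun _ : ℤ => ℝ) 2 →L[ℝ] lp (fun _ : ℤ => ℝ) 2))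
    (hH : ∀ (x : X) (ψ : lp (fun _ : ℤ => ℝ) 2) (n : ℤ),
      (H x ψ) n = ψ (n + 1) + ψ (n - 1) + f ((T.toEquiv ^ n) x) * ψ n)
    (hHsa : ∀ x, IsSelfAdjoint (H x))
    -- the unperturbed almost sure spectrum `Σ₀`
    (Λ₀ : Set ℝ) (hΛ₀compact : IsCompact Λ₀)
    (hΛ₀ : ∀ᵐ x ∂μ, spectrum ℝ (H x) = Λ₀)
    -- the energies
    (E₁ E₂ : ℝ) (hE : E₁ < E₂)
    (hUH₁ : UniformlyHyperbolic T (schrodingerCocycle (⇑f) E₁))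
    (hUH₂ : UniformlyHyperbolic T (schrodingerCocycle (⇑f) E₂)) :
    Set.Icc E₁ E₂ ∩ Λ₀ = ∅ ∨ Λ₀ ⊆ Set.Ioo E₁ E₂ ∨
      ∀ d₁ d₂ : C(X, RP1),
        IsUnstableSection T (schrodingerCocycle (⇑f) E₁) d₁ →
        IsUnstableSection T (schrodingerCocycle (⇑f) E₂) d₂ →
        ¬ d₁.Homotopic d₂ := by
  rw [← or_assoc]
  refine or_iff_not_imp_right.2 fun h => ?_
  push Not at h
  obtain ⟨d₁, d₂, hd₁, hd₂, hhom⟩ := h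
  obtain ⟨x, hx⟩ := hΛ₀.exists
  have hmem₁ : E₁ ∉ Λ₀ := hx ▸ hd₁.notMem_spectrum (hHsa x) (hH x)
  have hmem₂ : E₂ ∉ Λ₀ := hx ▸ hd₂.notMem_spectrum (hHsa x) (hH x)
  obtain ⟨ε, hε, hsign⟩ := wronskian_sign_of_homotopic hT hfull hE hd₁.1 hd₂.1 hhom
  obtain ⟨U₁, hU₁, hspan₁⟩ := hd₁.1.exists_orbit x
  obtain ⟨U₂, hU₂, hspan₂⟩ := hd₂.1.exists_orbit x
  obtain ⟨hrec₁, hprev₁⟩ := schrodingerCocycle_orbit hU₁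
  obtain ⟨hrec₂, hprev₂⟩ := schrodingerCocycle_orbit hU₂
  have hform := inner_sub_smul_nonneg_of_wronskian (u₁ := fun n => U₁ n 0)
    (u₂ := fun n => U₂ n 0) (ε := ε) (hH x) hrec₁ hrec₂ fun n => by
    simpa only [hrec₁, hrec₂, hprev₁, hprev₂] using hsign _ _ _ (hspan₁ n) (hspan₂ n)
  rcases hε with rfl | rfl
  · left
    refine Set.eq_empty_of_forall_notMem fun E hE' => ?_
    have h₁ : E ≠ E₁ := fun h => hmem₁ (h ▸ hE'.2)
    have h₂ : E ≠ E₂ := fun h => hmem₂ (h ▸ hE'.2)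
    exact notMem_spectrum_of_mem_Ioo (hHsa x) (fun ψ => by simpa only [one_mul] using hform ψ)
      ⟨lt_of_le_of_ne hE'.1.1 h₁.symm, lt_of_le_of_ne hE'.1.2 h₂⟩ (hx ▸ hE'.2)
  · right
    intro E hE'
    have hIcc := spectrum_subset_Icc (hHsa x) hE
      (fun ψ => by have := hform ψ; linarith) (hx ▸ hE' : E ∈ spectrum ℝ (H x))
    exact ⟨lt_of_le_of_ne hIcc.1 fun h => hmem₁ (h ▸ hE'),
      lt_of_le_of_ne hIcc.2 fun h => hmem₂ (h ▸ hE')⟩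

end
end
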